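/- Let α∈(0,1) and θ∈ℝ with α+θ>0, and let (K_n,(K_{r,n})_{r≥1}) be the Ewens–Pitman block-counting chain with parameters (α,θ). For r≥1 and n≥1 set Q_{r,n} = √(K_n)(P_{r,n}−p_α(r)). Then lim_{d→∞} sup_{n≥1} ∑_{r=d}^{∞} E[Q_{r,n}²] = 0; in particular, the sequence of ℓ²-valued random variables Q_n=(Q_{1,n},Q_{2,n},…) is tight in ℓ²(ℕ). -/

import Mathlib

open MeasureTheory ProbabilityTheory Filter Topology

noncomputable section

/-- Rising factorial `(a)^(m) = a (a+1) ⋯ (a+m-1)` of a real number. -/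
def risingFactorial (a : ℝ) : ℕ → ℝ
  | 0 => 1
  | m + 1 => risingFactorial a m * (a + m)

/-- Sibuya probabilities `p_α(r) = α (1-α)^(r-1) / r!` for `r ≥ 1`. -/
def sibuya (α : ℝ) (r : ℕ) : ℝ :=
  α * risingFactorial (1 - α) (r - 1) / (Nat.factorial r : ℝ)

/-- The Ewens–Pitman block-counting chain with parameters `(α, θ)` on a probability space
`(Ω, μ)` with filtration `F`: for `n ≥ 1`, `K n` is the number of blocks and `B r n` the
number of blocks of size `r` of the Ewens–Pitman random partition of `{1,…,n}`.
It starts from `K 1 = 1`, `B 1 1 = 1`, `B r 1 = 0` for `r ≥ 2`, and the transition from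
time `n` to `n+1` creates a new block with conditional probability `(α K n + θ)/(n + θ)`,
and grows a block of size `r` to size `r+1` with conditional probability
`(r - α) B r n / (n + θ)`. -/
structure IsEwensPitman (α θ : ℝ) {Ω : Type*} {mΩ : MeasurableSpace Ω}
    (μ : Measure Ω) (F : Filtration ℕ mΩ) (K : ℕ → Ω → ℕ) (B : ℕ → ℕ → Ω → ℕ) :
    Prop where
  prob : IsProbabilityMeasure μ
  meas_K : ∀ n, Measurable[F n] (K n)
  meas_B : ∀ r n, Measurable[F n] (B r n)
  init_K : ∀ᵐ ω ∂μ, K 1 ω = 1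
  init_B1 : ∀ᵐ ω ∂μ, B 1 1 ω = 1
  init_B : ∀ r, 2 ≤ r → ∀ᵐ ω ∂μ, B r 1 ω = 0
  B_eq_zero : ∀ r n, n < r → ∀ᵐ ω ∂μ, B r n ω = 0
  sum_blocks : ∀ n, 1 ≤ n → ∀ᵐ ω ∂μ, K n ω = ∑ r ∈ Finset.Icc 1 n, B r n ω
  sum_sizes : ∀ n, 1 ≤ n → ∀ᵐ ω ∂μ, n = ∑ r ∈ Finset.Icc 1 n, r * B r n ω
  trans_new : ∀ n, 1 ≤ n →
    μ[Set.indicator {ω | K (n+1) ω = K n ω + 1 ∧ B 1 (n+1) ω = B 1 n ω + 1 ∧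
        ∀ s, 2 ≤ s → B s (n+1) ω = B s n ω} (fun _ => (1:ℝ)) | F n]
      =ᵐ[μ] fun ω => (α * (K n ω : ℝ) + θ) / ((n : ℝ) + θ)
  trans_grow : ∀ n, 1 ≤ n → ∀ r, 1 ≤ r →
    μ[Set.indicator {ω | K (n+1) ω = K n ω ∧ B r (n+1) ω + 1 = B r n ω ∧
        B (r+1) (n+1) ω = B (r+1) n ω + 1 ∧
        ∀ s, 1 ≤ s → s ≠ r → s ≠ r + 1 → B s (n+1) ω = B s n ω} (fun _ => (1:ℝ)) | F n]
      =ᵐ[μ] fun ω => (((r : ℝ) - α) * (B r n ω : ℝ)) / ((n : ℝ) + θ)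

/-! ### Deterministic state facts -/

structure GoodState (n k : ℕ) (b : ℕ → ℕ) : Prop where
  hk : k = ∑ r ∈ Finset.Icc 1 n, b r
  hn : n = ∑ r ∈ Finset.Icc 1 n, r * b r
  hz : ∀ r, n < r → b r = 0

lemma GoodState.le {n k : ℕ} {b : ℕ → ℕ} (h : GoodState n k b) : k ≤ n := by
  have h1 : ∑ r ∈ Finset.Icc 1 n, b r ≤ ∑ r ∈ Finset.Icc 1 n, r * b r := by
    refine Finset.sum_le_sum fun r hr => ?_
    have := (Finset.mem_Icc.1 hr).1
    nlinarith
  rw [← h.hk, ← h.hn] at h1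
  exact h1

lemma GoodState.b_le {n k : ℕ} {b : ℕ → ℕ} (h : GoodState n k b) {r : ℕ} (hr : 1 ≤ r) :
    b r ≤ k := by
  by_cases h' : r ≤ n
  · rw [h.hk]
    exact Finset.single_le_sum (f := b) (fun _ _ => Nat.zero_le _) (Finset.mem_Icc.2 ⟨hr, h'⟩)
  · rw [h.hz r (by omega)]; exact Nat.zero_le _

lemma GoodState.pos {n k : ℕ} {b : ℕ → ℕ} (h : GoodState n k b) (hn : 1 ≤ n) : 1 ≤ k := by
  by_contra hk
  have hk0 : k = 0 := by omega
  have : n = 0 := by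
    rw [h.hn]
    refine Finset.sum_eq_zero fun r hr => ?_
    have := h.b_le (Finset.mem_Icc.1 hr).1
    have : b r = 0 := by omega
    simp [this]
  omega

/-- with one block, all blocks of size `< n` are absent -/
lemma GoodState.one {n : ℕ} {b : ℕ → ℕ} (h : GoodState n 1 b) {r : ℕ} (hr : 1 ≤ r)
    (hrn : r < n) : b r = 0 := by
  by_contra hb
  have hb1 : b r = 1 := by have := h.b_le hr; omega
  have hmem : r ∈ Finset.Icc 1 n := Finset.mem_Icc.2 ⟨hr, hrn.le⟩
  have h1 := h.hk
  rw [← Finset.add_sum_erase _ _ hmem, hb1] at h1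
  have h2 : ∑ x ∈ (Finset.Icc 1 n).erase r, b x = 0 := by omega
  rw [Finset.sum_eq_zero_iff] at h2
  have h3 := h.hn
  rw [← Finset.add_sum_erase _ _ hmem, hb1, Finset.sum_eq_zero] at h3
  · omega
  · intro x hx; rw [h2 x hx]; simp

/-- two distinct blocks of total size `n` : `K = 2`. -/
lemma GoodState.two {n k : ℕ} {b : ℕ → ℕ} (h : GoodState n k b) {r s : ℕ} (hr : 1 ≤ r)
    (hs : 1 ≤ s) (hrs : r + s = n)
    (hb : b r * b s - (if r = s then b r else 0) ≠ 0) : k = 2 := by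
  have hmem : r ∈ Finset.Icc 1 n := Finset.mem_Icc.2 ⟨hr, by omega⟩
  have h1 := h.hk
  have h3 := h.hn
  by_cases e : r = s
  · subst e
    rw [if_pos rfl] at hb
    have hb2 : 2 ≤ b r := by
      by_contra hc
      have : b r = 0 ∨ b r = 1 := by omega
      rcases this with h | h <;> simp [h] at hb
    rw [← Finset.add_sum_erase _ _ hmem] at h1 h3
    have hb3 : b r = 2 := by
      have e1 : r * b r ≤ r * 2 := by omega
      have e2 := Nat.le_of_mul_le_mul_left e1 (by omega)
      omega
    have h4 : ∑ x ∈ (Finset.Icc 1 n).erase r, x * b x = 0 := by rw [hb3] at h3; omega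
    rw [Finset.sum_eq_zero_iff] at h4
    rw [h1, hb3]
    rw [Finset.sum_eq_zero (s := (Finset.Icc 1 n).erase r)]
    · norm_num
    intro x hx
    have := h4 x hx
    have hx1 : 1 ≤ x := (Finset.mem_Icc.1 (Finset.mem_of_mem_erase hx)).1
    rcases Nat.mul_eq_zero.1 this with h | h <;> omega
  · rw [if_neg e] at hb
    have hbr : 1 ≤ b r := by
      by_contra hc
      have : b r = 0 := by omega
      simp [this] at hb
    have hbs : 1 ≤ b s := by
      by_contra hc
      have : b s = 0 := by omega
      simp [this] at hb
    have hmem2 : s ∈ (Finset.Icc 1 n).erase r :=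
      Finset.mem_erase.2 ⟨fun h => e h.symm, Finset.mem_Icc.2 ⟨hs, by omega⟩⟩
    rw [← Finset.add_sum_erase _ _ hmem, ← Finset.add_sum_erase _ _ hmem2] at h1 h3
    have e1 : r * b r ≥ r := by nlinarith
    have e2 : s * b s ≥ s := by nlinarith
    have h4 : ∑ x ∈ ((Finset.Icc 1 n).erase r).erase s, x * b x = 0 := by omega
    have e3 : r * b r = r * 1 := by omega
    have e4 : s * b s = s * 1 := by omega
    have e5 := Nat.eq_of_mul_eq_mul_left (by omega) e3
    have e6 := Nat.eq_of_mul_eq_mul_left (by omega) e4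
    rw [Finset.sum_eq_zero_iff] at h4
    rw [h1, e5, e6]
    rw [Finset.sum_eq_zero (s := ((Finset.Icc 1 n).erase r).erase s)]
    · norm_num
    intro x hx
    have := h4 x hx
    have hx1 : 1 ≤ x :=
      (Finset.mem_Icc.1 (Finset.mem_of_mem_erase (Finset.mem_of_mem_erase hx))).1
    rcases Nat.mul_eq_zero.1 this with h | h <;> omega

lemma IsEwensPitman.good {α θ : ℝ} {Ω : Type*} {mΩ : MeasurableSpace Ω}
    {μ : Measure Ω} {F : Filtration ℕ mΩ} {K : ℕ → Ω → ℕ} {B : ℕ → ℕ → Ω → ℕ}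
    (h : IsEwensPitman α θ μ F K B) {n : ℕ} (hn : 1 ≤ n) :
    ∀ᵐ ω ∂μ, GoodState n (K n ω) (fun r => B r n ω) := by
  have h3 : ∀ᵐ ω ∂μ, ∀ r, n < r → B r n ω = 0 := by
    rw [ae_all_iff]; intro r
    by_cases hr : n < r
    · filter_upwards [h.B_eq_zero r n hr] with ω hω _ using hω
    · exact Eventually.of_forall fun ω h => absurd h hr
  filter_upwards [h.sum_blocks n hn, h.sum_sizes n hn, h3] with ω h1 h2 h3
  exact ⟨h1, h2, h3⟩

/-! ### One step of the chain -/

def newSet {Ω : Type*} (K : ℕ → Ω → ℕ) (B : ℕ → ℕ → Ω → ℕ) (n : ℕ) : Set Ω :=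
  {ω | K (n+1) ω = K n ω + 1 ∧ B 1 (n+1) ω = B 1 n ω + 1 ∧
        ∀ s, 2 ≤ s → B s (n+1) ω = B s n ω}

def growSet {Ω : Type*} (K : ℕ → Ω → ℕ) (B : ℕ → ℕ → Ω → ℕ) (n r : ℕ) : Set Ω :=
  {ω | K (n+1) ω = K n ω ∧ B r (n+1) ω + 1 = B r n ω ∧
        B (r+1) (n+1) ω = B (r+1) n ω + 1 ∧
        ∀ s, 1 ≤ s → s ≠ r → s ≠ r + 1 → B s (n+1) ω = B s n ω}

section chain

variable {α θ : ℝ} {Ω : Type*} {mΩ : MeasurableSpace Ω}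
    {μ : Measure Ω} {F : Filtration ℕ mΩ} {K : ℕ → Ω → ℕ} {B : ℕ → ℕ → Ω → ℕ}

lemma IsEwensPitman.mK (h : IsEwensPitman α θ μ F K B) (n : ℕ) : Measurable (K n) :=
  (h.meas_K n).mono (F.le n) le_rfl

lemma IsEwensPitman.mB (h : IsEwensPitman α θ μ F K B) (r n : ℕ) : Measurable (B r n) :=
  (h.meas_B r n).mono (F.le n) le_rfl

lemma measurableSet_newSet (h : IsEwensPitman α θ μ F K B) (n : ℕ) :
    MeasurableSet (newSet K B n) := by
  have hK := h.mK
  have hB := h.mB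
  unfold newSet
  refine (measurableSet_eq_fun (hK _) ((hK n).add_const 1)).inter
    ((measurableSet_eq_fun (hB _ _) ((hB 1 n).add_const 1)).inter ?_)
  change MeasurableSet {ω | ∀ s, 2 ≤ s → B s (n+1) ω = B s n ω}
  simp only [Set.ofPred_forall]
  exact MeasurableSet.iInter fun s => MeasurableSet.iInter fun _ =>
    measurableSet_eq_fun (hB _ _) (hB _ _)

lemma measurableSet_growSet (h : IsEwensPitman α θ μ F K B) (n r : ℕ) :
    MeasurableSet (growSet K B n r) := by
  have hK := h.mK
  have hB := h.mB
  unfold growSet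
  refine (measurableSet_eq_fun (hK _) (hK n)).inter
    ((measurableSet_eq_fun ((hB _ _).add_const 1) (hB _ _)).inter
    ((measurableSet_eq_fun (hB _ _) ((hB _ n).add_const 1)).inter ?_))
  change MeasurableSet {ω | ∀ s, 1 ≤ s → s ≠ r → s ≠ r + 1 → B s (n+1) ω = B s n ω}
  simp only [Set.ofPred_forall]
  exact MeasurableSet.iInter fun s => MeasurableSet.iInter fun _ => MeasurableSet.iInter fun _ =>
    MeasurableSet.iInter fun _ => measurableSet_eq_fun (hB _ _) (hB _ _)

lemma pull_out [IsProbabilityMeasure μ] {n : ℕ} {A : Set Ω} (hA : MeasurableSet A)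
    {Y c : Ω → ℝ} (hY : Measurable[F n] Y) (hb : ∃ C, ∀ᵐ ω ∂μ, ‖Y ω‖ ≤ C)
    (hc : μ[A.indicator (fun _ => (1:ℝ)) | F n] =ᵐ[μ] c) :
    Integrable (fun ω => Y ω * A.indicator (fun _ => (1:ℝ)) ω) μ ∧
    Integrable (fun ω => Y ω * c ω) μ ∧
    ∫ ω, Y ω * A.indicator (fun _ => (1:ℝ)) ω ∂μ = ∫ ω, Y ω * c ω ∂μ := by
  obtain ⟨C, hC⟩ := hb
  have hI : Integrable (A.indicator (fun _ => (1:ℝ))) μ :=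
    (integrable_const (1:ℝ)).indicator hA
  have hY' : AEStronglyMeasurable Y μ :=
    (hY.mono (F.le n) le_rfl).aestronglyMeasurable
  have hYI : Integrable (Y * A.indicator (fun _ => (1:ℝ))) μ := hI.bdd_mul hY' hC
  have hci : Integrable c μ := integrable_condExp.congr hc
  refine ⟨hYI, hci.bdd_mul hY' hC, ?_⟩
  have h1 := condExp_mul_of_stronglyMeasurable_left (m := F n) (μ := μ)
    (hY.stronglyMeasurable) hYI hI
  calc ∫ ω, Y ω * A.indicator (fun _ => (1:ℝ)) ω ∂μ
      = ∫ ω, (μ[Y * A.indicator (fun _ => (1:ℝ)) | F n]) ω ∂μ := by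
        rw [integral_condExp (F.le n)]; rfl
    _ = ∫ ω, Y ω * c ω ∂μ := by
        refine integral_congr_ae ?_
        filter_upwards [h1, hc] with ω h1 h2
        rw [h1]; simp [h2]

lemma ind_sum (h : IsEwensPitman α θ μ F K B) (hα1 : α < 1) (hθ : 0 < α + θ)
    {n : ℕ} (hn : 1 ≤ n) :
    ∀ᵐ ω ∂μ, (newSet K B n).indicator (fun _ => (1:ℝ)) ω
      + ∑ t ∈ Finset.Icc 1 n, (growSet K B n t).indicator (fun _ => (1:ℝ)) ω = 1 := by
  have := h.prob
  have hn' : (1:ℝ) ≤ n := by exact_mod_cast hn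
  have hpos : 0 < (n:ℝ) + θ := by linarith
  have hb : ∃ C, ∀ᵐ ω ∂μ, ‖(1:ℝ)‖ ≤ C := ⟨1, by simp⟩
  have p0 := pull_out (F := F) (n := n) (μ := μ) (measurableSet_newSet h n)
    (Y := fun _ => 1) measurable_const hb (h.trans_new n hn)
  have pt : ∀ t ∈ Finset.Icc 1 n, _ := fun t ht =>
    pull_out (F := F) (n := n) (μ := μ) (measurableSet_growSet h n t)
    (Y := fun _ => 1) measurable_const hb (h.trans_grow n hn t (Finset.mem_Icc.1 ht).1)
  simp only [one_mul] at p0 pt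
  have hint : ∫ ω, ((newSet K B n).indicator (fun _ => (1:ℝ)) ω
      + ∑ t ∈ Finset.Icc 1 n, (growSet K B n t).indicator (fun _ => (1:ℝ)) ω) ∂μ = 1 := by
    rw [integral_add p0.1 (integrable_finsetSum _ fun t ht => (pt t ht).1), p0.2.2,
      integral_finsetSum _ fun t ht => (pt t ht).1,
      Finset.sum_congr rfl fun t ht => (pt t ht).2.2,
      ← integral_finsetSum _ fun t ht => (pt t ht).2.1,
      ← integral_add p0.2.1 (integrable_finsetSum _ fun t ht => (pt t ht).2.1)]
    have : ∀ᵐ ω ∂μ, (α * (K n ω : ℝ) + θ) / ((n : ℝ) + θ) + ∑ t ∈ Finset.Icc 1 n,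
        (((t : ℝ) - α) * (B t n ω : ℝ)) / ((n : ℝ) + θ) = 1 := by
      filter_upwards [h.good hn] with ω hg
      have h1 : (K n ω : ℝ) = ∑ t ∈ Finset.Icc 1 n, (B t n ω : ℝ) := by exact_mod_cast hg.hk
      have h2 : (n : ℝ) = ∑ t ∈ Finset.Icc 1 n, (t:ℝ) * (B t n ω : ℝ) := by
        exact_mod_cast hg.hn
      rw [← Finset.sum_div, ← add_div, div_eq_one_iff_eq hpos.ne']
      simp only [sub_mul, Finset.sum_sub_distrib, ← Finset.mul_sum, ← h1, ← h2]
      ring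
    rw [integral_congr_ae this]; simp
  have hle : ∀ ω, (newSet K B n).indicator (fun _ => (1:ℝ)) ω
      + ∑ t ∈ Finset.Icc 1 n, (growSet K B n t).indicator (fun _ => (1:ℝ)) ω ≤ 1 := by
    intro ω
    by_cases h0 : ω ∈ newSet K B n
    · rw [Set.indicator_of_mem h0, Finset.sum_eq_zero]
      · simp
      · intro t _
        refine Set.indicator_of_notMem (fun ht => ?_) _
        have := h0.1; have := ht.1; omega
    · rw [Set.indicator_of_notMem h0, zero_add]
      by_cases h1 : ∃ t ∈ Finset.Icc 1 n, ω ∈ growSet K B n t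
      · obtain ⟨t, ht, hω⟩ := h1
        rw [Finset.sum_eq_single t]
        · exact Set.indicator_le' (fun _ _ => le_rfl) (fun _ _ => zero_le_one) ω
        · intro s hs hst
          refine Set.indicator_of_notMem (fun hs' => ?_) _
          have a1 := hω.2.1
          by_cases e : t = s + 1
          · subst e
            have := hs'.2.2.1; omega
          · have := hs'.2.2.2 t (Finset.mem_Icc.1 ht).1 (fun h => hst h.symm) e
            omega
        · intro h; exact absurd ht h
      · rw [Finset.sum_eq_zero]
        · exact zero_le_one
        · intro t ht
          exact Set.indicator_of_notMem (fun hs' => h1 ⟨t, ht, hs'⟩) _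
  have hIS : Integrable (fun ω => (newSet K B n).indicator (fun _ => (1:ℝ)) ω
      + ∑ t ∈ Finset.Icc 1 n, (growSet K B n t).indicator (fun _ => (1:ℝ)) ω) μ :=
    p0.1.add (integrable_finsetSum _ fun t ht => (pt t ht).1)
  have h0 : ∫ ω, (1 - ((newSet K B n).indicator (fun _ => (1:ℝ)) ω
      + ∑ t ∈ Finset.Icc 1 n, (growSet K B n t).indicator (fun _ => (1:ℝ)) ω)) ∂μ = 0 := by
    rw [integral_sub (integrable_const _) hIS, hint]; simp
  rw [integral_eq_zero_iff_of_nonneg (fun ω => sub_nonneg.2 (hle ω))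
    ((integrable_const _).sub hIS)] at h0
  filter_upwards [h0] with ω hω
  have : 1 - ((newSet K B n).indicator (fun _ => (1:ℝ)) ω
      + ∑ t ∈ Finset.Icc 1 n, (growSet K B n t).indicator (fun _ => (1:ℝ)) ω) = 0 := hω
  linarith

lemma step (h : IsEwensPitman α θ μ F K B) (hα1 : α < 1) (hθ : 0 < α + θ)
    {n : ℕ} (hn : 1 ≤ n) {X Y0 : Ω → ℝ} {Y : ℕ → Ω → ℝ}
    (m0 : Measurable[F n] Y0) (mt : ∀ t, Measurable[F n] (Y t))
    (b0 : ∃ C, ∀ᵐ ω ∂μ, ‖Y0 ω‖ ≤ C) (bt : ∀ t, ∃ C, ∀ᵐ ω ∂μ, ‖Y t ω‖ ≤ C)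
    (x0 : ∀ᵐ ω ∂μ, ω ∈ newSet K B n → X ω = Y0 ω)
    (xt : ∀ t ∈ Finset.Icc 1 n, ∀ᵐ ω ∂μ, ω ∈ growSet K B n t → X ω = Y t ω) :
    Integrable (fun ω => ((α * K n ω + θ) * Y0 ω
      + ∑ t ∈ Finset.Icc 1 n, ((t:ℝ) - α) * B t n ω * Y t ω) / ((n:ℝ) + θ)) μ ∧
    ∫ ω, X ω ∂μ = ∫ ω, ((α * K n ω + θ) * Y0 ω
      + ∑ t ∈ Finset.Icc 1 n, ((t:ℝ) - α) * B t n ω * Y t ω) / ((n:ℝ) + θ) ∂μ := by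
  have := h.prob
  have p0 := pull_out (F := F) (n := n) (μ := μ) (measurableSet_newSet h n)
    m0 b0 (h.trans_new n hn)
  have pt : ∀ t ∈ Finset.Icc 1 n, _ := fun t ht =>
    pull_out (F := F) (n := n) (μ := μ) (measurableSet_growSet h n t)
    (mt t) (bt t) (h.trans_grow n hn t (Finset.mem_Icc.1 ht).1)
  have e : (fun ω => ((α * K n ω + θ) * Y0 ω
      + ∑ t ∈ Finset.Icc 1 n, ((t:ℝ) - α) * B t n ω * Y t ω) / ((n:ℝ) + θ)) =
      fun ω => Y0 ω * ((α * (K n ω : ℝ) + θ) / ((n : ℝ) + θ)) + ∑ t ∈ Finset.Icc 1 n,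
        Y t ω * ((((t : ℝ) - α) * (B t n ω : ℝ)) / ((n : ℝ) + θ)) := by
    funext ω
    rw [add_div, Finset.sum_div]
    congr 1
    · ring
    · exact Finset.sum_congr rfl fun t _ => by ring
  rw [e]
  refine ⟨p0.2.1.add (integrable_finsetSum _ fun t ht => (pt t ht).2.1), ?_⟩
  rw [integral_add p0.2.1 (integrable_finsetSum _ fun t ht => (pt t ht).2.1),
      integral_finsetSum _ fun t ht => (pt t ht).2.1, ← p0.2.2,
      ← Finset.sum_congr rfl fun t ht => (pt t ht).2.2,
      ← integral_finsetSum _ fun t ht => (pt t ht).1,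
      ← integral_add p0.1 (integrable_finsetSum _ fun t ht => (pt t ht).1)]
  refine integral_congr_ae ?_
  have xt' : ∀ᵐ ω ∂μ, ∀ t ∈ Finset.Icc 1 n, ω ∈ growSet K B n t → X ω = Y t ω :=
    (Finset.eventually_all _).2 xt
  filter_upwards [ind_sum h hα1 hθ hn, x0, xt'] with ω h1 h2 h3
  calc X ω = X ω * ((newSet K B n).indicator (fun _ => (1:ℝ)) ω
      + ∑ t ∈ Finset.Icc 1 n, (growSet K B n t).indicator (fun _ => (1:ℝ)) ω) := by
        rw [h1, mul_one]
    _ = _ := by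
        rw [mul_add, Finset.mul_sum]
        congr 1
        · by_cases hω : ω ∈ newSet K B n
          · rw [h2 hω]
          · rw [Set.indicator_of_notMem hω]; simp
        · refine Finset.sum_congr rfl fun t ht => ?_
          by_cases hω : ω ∈ growSet K B n t
          · rw [h3 t ht hω]
          · rw [Set.indicator_of_notMem hω]; simp

/-- functions of finitely many (here three) counts are measurable and bounded. -/
lemma fn_meas (h : IsEwensPitman α θ μ F K B) (n r s : ℕ) (f : ℕ → ℕ → ℕ → ℝ) :
    Measurable[F n] (fun ω => f (K n ω) (B r n ω) (B s n ω)) := by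
  have : Measurable (fun p : ℕ × ℕ × ℕ => f p.1 p.2.1 p.2.2) := measurable_of_countable _
  exact this.comp ((h.meas_K n).prodMk ((h.meas_B r n).prodMk (h.meas_B s n)))

lemma fn_bdd (h : IsEwensPitman α θ μ F K B) {n r s : ℕ} (hn : 1 ≤ n) (hr : 1 ≤ r)
    (hs : 1 ≤ s) (f : ℕ → ℕ → ℕ → ℝ) :
    ∃ C, ∀ᵐ ω ∂μ, ‖f (K n ω) (B r n ω) (B s n ω)‖ ≤ C := by
  refine ⟨∑ i ∈ Finset.range (n+1), ∑ j ∈ Finset.range (n+1), ∑ l ∈ Finset.range (n+1),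
    ‖f i j l‖, ?_⟩
  filter_upwards [h.good hn] with ω hg
  have h1 := hg.le
  have h2 := hg.b_le hr
  have h3 := hg.b_le hs
  calc ‖f (K n ω) (B r n ω) (B s n ω)‖
      ≤ ∑ l ∈ Finset.range (n+1), ‖f (K n ω) (B r n ω) l‖ :=
        Finset.single_le_sum (f := fun l => ‖f (K n ω) (B r n ω) l‖)
          (fun _ _ => norm_nonneg _) (Finset.mem_range.2 (by omega))
    _ ≤ ∑ j ∈ Finset.range (n+1), ∑ l ∈ Finset.range (n+1), ‖f (K n ω) j l‖ :=
        Finset.single_le_sum (f := fun j => ∑ l ∈ Finset.range (n+1), ‖f (K n ω) j l‖)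
          (fun _ _ => Finset.sum_nonneg fun _ _ => norm_nonneg _)
          (Finset.mem_range.2 (by omega))
    _ ≤ _ :=
        Finset.single_le_sum (f := fun i => ∑ j ∈ Finset.range (n+1),
          ∑ l ∈ Finset.range (n+1), ‖f i j l‖)
          (fun _ _ => Finset.sum_nonneg fun _ _ => Finset.sum_nonneg fun _ _ => norm_nonneg _)
          (Finset.mem_range.2 (by omega))

lemma fn_int (h : IsEwensPitman α θ μ F K B) {n r s : ℕ} (hn : 1 ≤ n) (hr : 1 ≤ r)
    (hs : 1 ≤ s) (f : ℕ → ℕ → ℕ → ℝ) :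
    Integrable (fun ω => f (K n ω) (B r n ω) (B s n ω)) μ := by
  have := h.prob
  obtain ⟨C, hC⟩ := fn_bdd h hn hr hs f
  exact Integrable.of_bound
    ((fn_meas h n r s f).mono (F.le n) le_rfl).aestronglyMeasurable C hC



def cc (t r : ℕ) : ℝ := (if r = t + 1 then 1 else 0) - (if r = t then 1 else 0)

lemma newSet_B {n r : ℕ} {ω : Ω} (hω : ω ∈ newSet K B n) (hr : 1 ≤ r) :
    (B r (n+1) ω : ℝ) = B r n ω + if r = 1 then 1 else 0 := by
  split_ifs with h
  · subst h; rw [hω.2.1]; push_cast; ring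
  · rw [hω.2.2 r (by omega)]; simp

lemma growSet_B {n r t : ℕ} {ω : Ω} (hω : ω ∈ growSet K B n t) (hr : 1 ≤ r) :
    (B r (n+1) ω : ℝ) = B r n ω + cc t r := by
  unfold cc
  by_cases h1 : r = t
  · subst h1
    rw [← hω.2.1]; simp
  · by_cases h2 : r = t + 1
    · subst h2
      rw [hω.2.2.1]; simp
    · rw [hω.2.2.2 r hr h1 h2]; simp [h1, h2]

lemma GoodState.sum_rate {n k : ℕ} {b : ℕ → ℕ} (h : GoodState n k b) (α : ℝ) :
    ∑ t ∈ Finset.Icc 1 n, ((t:ℝ) - α) * b t = n - α * k := by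
  have h1 : (k : ℝ) = ∑ t ∈ Finset.Icc 1 n, (b t : ℝ) := by exact_mod_cast h.hk
  have h2 : (n : ℝ) = ∑ t ∈ Finset.Icc 1 n, (t:ℝ) * (b t : ℝ) := by
    exact_mod_cast h.hn
  simp only [sub_mul, Finset.sum_sub_distrib, ← Finset.mul_sum, ← h1, ← h2]

lemma rpow_step {β : ℝ} (hβ0 : 0 < β) (hβ1 : β ≤ 1) {t : ℕ} (ht : 1 ≤ t) :
    (t:ℝ) * (((t + 1 : ℕ) : ℝ) ^ β - (t:ℝ) ^ β) ≤ β * (t:ℝ) ^ β := by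
  have ht' : (0:ℝ) < t := by exact_mod_cast ht
  have h1 : ((t + 1 : ℕ) : ℝ) = t * (1 + 1 / t) := by push_cast; field_simp
  have h2 : (1 + 1 / (t:ℝ)) ^ β ≤ 1 + β * (1 / t) :=
    rpow_one_add_le_one_add_mul_self (le_trans (by norm_num) (by positivity : (0:ℝ) ≤ 1 / (t:ℝ)))
      hβ0.le hβ1
  rw [h1, Real.mul_rpow ht'.le (by positivity)]
  have h3 : 0 < (t:ℝ) ^ β := Real.rpow_pos_of_pos ht' _
  have h4 : (t:ℝ) ^ β * (1 + 1 / (t:ℝ)) ^ β ≤ (t:ℝ) ^ β * (1 + β * (1 / t)) := by gcongr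
  calc (t:ℝ) * ((t:ℝ) ^ β * (1 + 1 / (t:ℝ)) ^ β - (t:ℝ) ^ β)
      ≤ t * ((t:ℝ) ^ β * (1 + β * (1 / t)) - (t:ℝ) ^ β) := by gcongr
    _ = β * (t:ℝ) ^ β := by field_simp; ring

def Gs (β : ℝ) (n : ℕ) (b : ℕ → ℕ) : ℝ := ∑ r ∈ Finset.Icc 1 n, (r:ℝ) ^ β * b r

lemma Gs_nonneg (β : ℝ) (n : ℕ) (b : ℕ → ℕ) : 0 ≤ Gs β n b :=
  Finset.sum_nonneg fun r _ => by positivity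

lemma Gs_le {β : ℝ} {n k : ℕ} {b : ℕ → ℕ} (h : GoodState n k b) :
    Gs β n b ≤ ∑ r ∈ Finset.Icc 1 n, (r:ℝ) ^ β * n := by
  refine Finset.sum_le_sum fun r hr => ?_
  have h1 : b r ≤ n := (h.b_le (Finset.mem_Icc.1 hr).1).trans h.le
  have h2 : (b r : ℝ) ≤ n := by exact_mod_cast h1
  gcongr

lemma Gs_new {β : ℝ} {n : ℕ} {ω : Ω} (hg : GoodState n (K n ω) (fun r => B r n ω))
    (hω : ω ∈ newSet K B n) :
    Gs β (n+1) (fun r => B r (n+1) ω) = Gs β n (fun r => B r n ω) + 1 := by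
  unfold Gs
  have : ∀ r ∈ Finset.Icc 1 (n+1), (r:ℝ) ^ β * (B r (n+1) ω : ℝ)
      = (r:ℝ) ^ β * B r n ω + if r = 1 then 1 else 0 := by
    intro r hr
    rw [newSet_B hω (Finset.mem_Icc.1 hr).1]
    split_ifs with h
    · subst h; simp
    · simp
  rw [Finset.sum_congr rfl this, Finset.sum_add_distrib, Finset.sum_ite_eq',
    Finset.sum_Icc_succ_top (by omega), if_pos (by simp)]
  rw [hg.hz (n+1) (by omega)]; simp

lemma Gs_grow {β : ℝ} {n t : ℕ} {ω : Ω} (hg : GoodState n (K n ω) (fun r => B r n ω))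
    (ht : t ∈ Finset.Icc 1 n) (hω : ω ∈ growSet K B n t) :
    Gs β (n+1) (fun r => B r (n+1) ω) = Gs β n (fun r => B r n ω)
      + (((t + 1 : ℕ) : ℝ) ^ β - (t:ℝ) ^ β) := by
  unfold Gs
  have ht' := Finset.mem_Icc.1 ht
  have : ∀ r ∈ Finset.Icc 1 (n+1), (r:ℝ) ^ β * (B r (n+1) ω : ℝ)
      = (r:ℝ) ^ β * B r n ω + ((if r = t + 1 then (r:ℝ) ^ β else 0)
        - (if r = t then (r:ℝ) ^ β else 0)) := by
    intro r hr
    rw [growSet_B hω (Finset.mem_Icc.1 hr).1]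
    unfold cc
    rw [mul_add, mul_sub]
    simp only [mul_ite, mul_one, mul_zero]
  rw [Finset.sum_congr rfl this, Finset.sum_add_distrib, Finset.sum_sub_distrib,
    Finset.sum_ite_eq', Finset.sum_ite_eq',
    Finset.sum_Icc_succ_top (by omega), if_pos (by simp; omega), if_pos (by simp; omega)]
  rw [hg.hz (n+1) (by omega)]; simp

lemma G_bound (h : IsEwensPitman α θ μ F K B) (hα0 : 0 < α) (hα1 : α < 1)
    (hθ : 0 < α + θ) {β : ℝ} (hβ0 : 0 < β) (hβ1 : β ≤ 1) (hβα : 2 * β ≤ α)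
    (hβθ : 4 * β ≤ α + θ) {n : ℕ} (hn : 1 ≤ n) :
    Integrable (fun ω => Gs β n (fun r => B r n ω) / (K n ω : ℝ)) μ ∧
    ∫ ω, Gs β n (fun r => B r n ω) / (K n ω : ℝ) ∂μ ≤ 1 + (α + |θ|) / β := by
  have hprob := h.prob
  have mG : ∀ n, Measurable[F n] (fun ω => Gs β n (fun r => B r n ω)) := by
    intro n
    unfold Gs
    refine Finset.measurable_sum _ fun r _ => ?_
    exact fn_meas h n r r (fun _ b _ => (r:ℝ) ^ β * b)
  have mK : ∀ n, Measurable[F n] (fun ω => (K n ω : ℝ)) := fun n =>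
    fn_meas h n 1 1 (fun k _ _ => (k:ℝ))
  have hint : ∀ n, 1 ≤ n → Integrable (fun ω => Gs β n (fun r => B r n ω) / (K n ω : ℝ)) μ := by
    intro n hn
    refine Integrable.of_bound
      (((mG n).div (mK n)).mono (F.le n) le_rfl).aestronglyMeasurable
      (∑ r ∈ Finset.Icc 1 n, (r:ℝ) ^ β * n) ?_
    filter_upwards [h.good hn] with ω hg
    have hk : (1:ℝ) ≤ K n ω := by exact_mod_cast hg.pos hn
    rw [Real.norm_of_nonneg (div_nonneg (Gs_nonneg _ _ _) (by positivity))]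
    exact (div_le_self (Gs_nonneg _ _ _) hk).trans (Gs_le hg)
  refine ⟨hint n hn, ?_⟩
  set c := 1 + (α + |θ|) / β with hc
  have hc1 : α + |θ| ≤ β * c := by
    rw [hc, mul_add, mul_div_cancel₀ _ hβ0.ne']; linarith
  have hab : 0 ≤ α + |θ| := by positivity
  induction n, hn using Nat.le_induction with
  | base =>
    have : ∀ᵐ ω ∂μ, Gs β 1 (fun r => B r 1 ω) / (K 1 ω : ℝ) = 1 := by
      filter_upwards [h.init_K, h.init_B1] with ω h1 h2
      simp [Gs, h1, h2]
    rw [integral_congr_ae this]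
    simp only [integral_const, probReal_univ, smul_eq_mul, mul_one]
    rw [hc]
    have : 0 ≤ (α + |θ|) / β := by positivity
    linarith
  | succ n hn ih =>
    have hn' : (1:ℝ) ≤ n := by exact_mod_cast hn
    have hpos : 0 < (n:ℝ) + θ := by linarith
    have st := step h hα1 hθ hn (X := fun ω => Gs β (n+1) (fun r => B r (n+1) ω) / (K (n+1) ω : ℝ))
      (Y0 := fun ω => (Gs β n (fun r => B r n ω) + 1) / ((K n ω : ℝ) + 1))
      (Y := fun t ω => (Gs β n (fun r => B r n ω)
        + (((t + 1 : ℕ) : ℝ) ^ β - (t:ℝ) ^ β)) / (K n ω : ℝ))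
      (((mG n).add_const _).div ((mK n).add_const _))
      (fun t => ((mG n).add_const _).div (mK n))
      (by
        refine ⟨(∑ r ∈ Finset.Icc 1 n, (r:ℝ) ^ β * n) + 1, ?_⟩
        filter_upwards [h.good hn] with ω hg
        have hG := Gs_nonneg β n (fun r => B r n ω)
        have hG' := Gs_le (β := β) hg
        rw [Real.norm_of_nonneg (by positivity)]
        refine (div_le_self (by positivity) ?_).trans (by linarith)
        have : (0:ℝ) ≤ K n ω := by positivity
        linarith)
      (by
        intro t
        refine ⟨(∑ r ∈ Finset.Icc 1 n, (r:ℝ) ^ β * n)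
          + |((t + 1 : ℕ) : ℝ) ^ β - (t:ℝ) ^ β|, ?_⟩
        filter_upwards [h.good hn] with ω hg
        have hG := Gs_nonneg β n (fun r => B r n ω)
        have hG' := Gs_le (β := β) hg
        have hk : (1:ℝ) ≤ K n ω := by exact_mod_cast hg.pos hn
        rw [norm_div, Real.norm_of_nonneg (show (0:ℝ) ≤ K n ω by positivity)]
        refine (div_le_self (norm_nonneg _) hk).trans ?_
        refine (norm_add_le _ _).trans ?_
        rw [Real.norm_of_nonneg hG, Real.norm_eq_abs]
        linarith)
      (by
        filter_upwards [h.good hn] with ω hg hω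
        rw [Gs_new hg hω, hω.1]; push_cast; rfl)
      (by
        intro t ht
        filter_upwards [h.good hn] with ω hg hω
        rw [Gs_grow hg ht hω, hω.1])
    have key : ∀ᵐ ω ∂μ, ((α * K n ω + θ) * ((Gs β n (fun r => B r n ω) + 1) / ((K n ω : ℝ) + 1))
      + ∑ t ∈ Finset.Icc 1 n, ((t:ℝ) - α) * B t n ω * ((Gs β n (fun r => B r n ω)
        + (((t + 1 : ℕ) : ℝ) ^ β - (t:ℝ) ^ β)) / (K n ω : ℝ))) / ((n:ℝ) + θ)
        ≤ (1 - β / (n + θ)) * (Gs β n (fun r => B r n ω) / (K n ω : ℝ))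
          + (α + |θ|) / (n + θ) := by
      filter_upwards [h.good hn] with ω hg
      have hk : (1:ℝ) ≤ K n ω := by exact_mod_cast hg.pos hn
      have hG := Gs_nonneg β n (fun r => B r n ω)
      have hs := hg.sum_rate α
      have hs2 : ∑ t ∈ Finset.Icc 1 n, ((t:ℝ) - α) * B t n ω *
          (((t + 1 : ℕ) : ℝ) ^ β - (t:ℝ) ^ β) ≤ β * Gs β n (fun r => B r n ω) := by
        rw [Gs, Finset.mul_sum]
        refine Finset.sum_le_sum fun t ht => ?_
        have ht1 := (Finset.mem_Icc.1 ht).1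
        have := rpow_step hβ0 hβ1 ht1
        have mono : 0 ≤ ((t + 1 : ℕ) : ℝ) ^ β - (t:ℝ) ^ β := by
          rw [sub_nonneg]
          refine Real.rpow_le_rpow (by positivity) (by push_cast; linarith) hβ0.le
        have h5 : ((t:ℝ) - α) * (((t + 1 : ℕ) : ℝ) ^ β - (t:ℝ) ^ β) ≤ β * (t:ℝ) ^ β := by
          nlinarith
        have h6 : (0:ℝ) ≤ B t n ω := by positivity
        calc _ = (((t:ℝ) - α) * (((t + 1 : ℕ) : ℝ) ^ β - (t:ℝ) ^ β)) * B t n ω := by ring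
          _ ≤ (β * (t:ℝ) ^ β) * B t n ω := by gcongr
          _ = _ := by ring
      have hs3 : ∑ t ∈ Finset.Icc 1 n, ((t:ℝ) - α) * B t n ω * ((Gs β n (fun r => B r n ω)
        + (((t + 1 : ℕ) : ℝ) ^ β - (t:ℝ) ^ β)) / (K n ω : ℝ))
        ≤ ((n - α * K n ω) * Gs β n (fun r => B r n ω)
            + β * Gs β n (fun r => B r n ω)) / (K n ω : ℝ) := by
        rw [← hs, Finset.sum_mul]
        calc _ = (∑ t ∈ Finset.Icc 1 n, ((t:ℝ) - α) * B t n ω * Gs β n (fun r => B r n ω)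
              + ∑ t ∈ Finset.Icc 1 n, ((t:ℝ) - α) * B t n ω *
          (((t + 1 : ℕ) : ℝ) ^ β - (t:ℝ) ^ β)) / (K n ω : ℝ) := by
              rw [← Finset.sum_add_distrib, Finset.sum_div]
              exact Finset.sum_congr rfl fun t _ => by ring
          _ ≤ _ := by gcongr
      generalize Gs β n (fun r => B r n ω) = G at *
      generalize (K n ω : ℝ) = k at *
      have hk0 : 0 < k := by linarith
      have h7 : (α * k + θ) * (G / (k+1)) ≤ (α * k + θ - 2 * β) * (G / k) := by
        rw [← mul_div_assoc, ← mul_div_assoc, div_le_div_iff₀ (by linarith) hk0]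
        have : 0 ≤ α * k + θ - 2 * β * (k + 1) := by nlinarith
        nlinarith [mul_nonneg this hG]
      have h8 : (α * k + θ) * (1 / (k+1)) ≤ α + |θ| := by
        rw [mul_one_div, div_le_iff₀ (by linarith)]
        nlinarith [le_abs_self θ, abs_nonneg θ]
      rw [div_le_iff₀ hpos]
      have e1 : ((1 - β / (n + θ)) * (G / k) + (α + |θ|) / (n + θ)) * (n + θ)
          = (n + θ - β) * (G / k) + (α + |θ|) := by field_simp
      rw [e1]
      have e2 : (α * k + θ) * ((G + 1) / (k + 1)) = (α * k + θ) * (G / (k+1))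
        + (α * k + θ) * (1 / (k+1)) := by ring
      have e3 : ((n - α * k) * G + β * G) / k = (n - α * k + β) * (G / k) := by ring
      rw [e3] at hs3
      rw [e2]
      nlinarith
    rw [st.2]
    have hI := hint n hn
    refine (integral_mono_ae st.1 ((hI.const_mul _).add (integrable_const _)) key).trans ?_
    rw [integral_add' (hI.const_mul _) (integrable_const _), integral_const_mul]
    simp only [integral_const, probReal_univ, smul_eq_mul, one_mul]
    have hco : 0 ≤ 1 - β / (n + θ) := by
      rw [sub_nonneg, div_le_one hpos]; linarith
    calc _ ≤ (1 - β / (n + θ)) * c + (α + |θ|) / (n + θ) := by gcongr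
      _ ≤ (1 - β / (n + θ)) * c + (β * c) / (n + θ) := by gcongr
      _ = c := by ring

lemma EK_step (h : IsEwensPitman α θ μ F K B) (hα1 : α < 1)
    (hθ : 0 < α + θ) {n : ℕ} (hn : 1 ≤ n) :
    ∫ ω, (α * (K (n+1) ω : ℝ) + θ) ∂μ
      = (1 + α / (n + θ)) * ∫ ω, (α * (K n ω : ℝ) + θ) ∂μ := by
  have hn' : (1:ℝ) ≤ n := by exact_mod_cast hn
  have hpos : 0 < (n:ℝ) + θ := by linarith
  have st := step h hα1 hθ hn (X := fun ω => (α * (K (n+1) ω : ℝ) + θ))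
    (Y0 := fun ω => (α * ((K n ω : ℝ) + 1) + θ)) (Y := fun t ω => (α * (K n ω : ℝ) + θ))
    (fn_meas h n 1 1 fun k _ _ => (α * ((k : ℝ) + 1) + θ))
    (fun _ => fn_meas h n 1 1 fun k _ _ => (α * (k : ℝ) + θ))
    (fn_bdd h hn le_rfl le_rfl fun k _ _ => (α * ((k : ℝ) + 1) + θ))
    (fun _ => fn_bdd h hn le_rfl le_rfl fun k _ _ => (α * (k : ℝ) + θ))
    (Eventually.of_forall fun ω hω => by rw [hω.1]; push_cast; rfl)
    (fun t _ => Eventually.of_forall fun ω hω => by rw [hω.1])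
  rw [st.2, ← integral_const_mul]
  refine integral_congr_ae ?_
  filter_upwards [h.good hn] with ω hg
  rw [← Finset.sum_mul, hg.sum_rate α]
  field_simp
  ring

lemma EK_bound (h : IsEwensPitman α θ μ F K B) (hα0 : 0 < α) (hα1 : α < 1)
    (hθ : 0 < α + θ) : ∃ C, 0 ≤ C ∧ ∀ n : ℕ, 1 ≤ n →
      ∫ ω, (α * (K n ω : ℝ) + θ) ∂μ ≤ C * (n:ℝ) ^ α := by
  set e : ℕ → ℝ := fun n => ∫ ω, (α * (K n ω : ℝ) + θ) ∂μ with he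
  have hst : ∀ n, 1 ≤ n → e (n+1) = (1 + α / (n + θ)) * e n := fun n hn => EK_step h hα1 hθ hn
  have e0 : ∀ n, 1 ≤ n → 0 ≤ e n := by
    intro n hn
    refine integral_nonneg_of_ae ?_
    filter_upwards [h.good hn] with ω hg
    have hk : (1:ℝ) ≤ K n ω := by exact_mod_cast hg.pos hn
    show 0 ≤ α * (K n ω : ℝ) + θ
    nlinarith
  set x : ℝ := (1 + θ) ^ α with hx
  have hx0 : 0 < x := Real.rpow_pos_of_pos (by linarith) _
  have h2 : ∀ n : ℕ, 2 ≤ n → e n ≤ e 2 / x * ((n:ℝ) - 1 + θ) ^ α := by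
    intro n hn
    induction n, hn using Nat.le_induction with
    | base =>
      have : ((2:ℕ):ℝ) - 1 + θ = 1 + θ := by push_cast; ring
      rw [this, ← hx, div_mul_cancel₀ _ hx0.ne']
    | succ n hn ih =>
      have hn' : (2:ℝ) ≤ n := by exact_mod_cast hn
      have hpos : 0 < (n:ℝ) - 1 + θ := by linarith
      have hpos' : 0 < (n:ℝ) + θ := by linarith
      rw [hst n (by omega)]
      have e1 : ((n + 1 : ℕ):ℝ) - 1 + θ = n + θ := by push_cast; ring
      rw [e1]
      have e2 : (n:ℝ) - 1 + θ = (n + θ) * (1 + (-(1 / (n + θ)))) := by field_simp; ring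
      have e3 : (1 + (-(1 / ((n:ℝ) + θ)))) ^ α ≤ 1 + α * (-(1 / (n + θ))) := by
        refine rpow_one_add_le_one_add_mul_self ?_ hα0.le hα1.le
        rw [neg_le_neg_iff, div_le_one hpos']; linarith
      have e4 : 0 < ((n:ℝ) + θ) ^ α := Real.rpow_pos_of_pos hpos' _
      have hge : 0 ≤ 1 + (-(1 / ((n:ℝ) + θ))) := by
        have : 1 / ((n:ℝ) + θ) ≤ 1 := by rw [div_le_one hpos']; linarith
        linarith
      have e5 : (1 + α / (n + θ)) * ((n:ℝ) - 1 + θ) ^ α ≤ (n + θ) ^ α := by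
        rw [e2, Real.mul_rpow hpos'.le hge]
        calc _ ≤ (1 + α / (n + θ)) * ((n + θ) ^ α * (1 + α * (-(1 / (n + θ))))) := by
              gcongr
          _ = (n + θ) ^ α * (1 - (α / (n + θ)) ^ 2) := by ring
          _ ≤ (n + θ) ^ α * 1 := by
              gcongr; nlinarith [sq_nonneg (α / (n + θ))]
          _ = _ := mul_one _
      have : 0 ≤ e 2 / x := div_nonneg (e0 2 (by norm_num)) hx0.le
      calc (1 + α / (n + θ)) * e n
          ≤ (1 + α / (n + θ)) * (e 2 / x * ((n:ℝ) - 1 + θ) ^ α) := by gcongr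
        _ = e 2 / x * ((1 + α / (n + θ)) * ((n:ℝ) - 1 + θ) ^ α) := by ring
        _ ≤ _ := by gcongr
  have h3 := e0 1 le_rfl
  have h4 : 0 ≤ e 2 / x := div_nonneg (e0 2 (by norm_num)) hx0.le
  have h5 : 0 < (1 + |θ|) ^ α := Real.rpow_pos_of_pos (by positivity) _
  refine ⟨e 1 + e 2 / x * (1 + |θ|) ^ α, by positivity, ?_⟩
  intro n hn
  rcases Nat.lt_or_ge n 2 with hlt | hge
  · have : n = 1 := by omega
    subst this
    show e 1 ≤ _
    simp only [Nat.cast_one, Real.one_rpow, mul_one]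
    have : 0 ≤ e 2 / x * (1 + |θ|) ^ α := by positivity
    linarith
  · refine (h2 n hge).trans ?_
    have hn' : (2:ℝ) ≤ n := by exact_mod_cast hge
    have : ((n:ℝ) - 1 + θ) ^ α ≤ (1 + |θ|) ^ α * (n:ℝ) ^ α := by
      rw [← Real.mul_rpow (by positivity) (by positivity)]
      refine Real.rpow_le_rpow (by linarith) ?_ hα0.le
      nlinarith [le_abs_self θ, abs_nonneg θ]
    have h6 : 0 ≤ (n:ℝ) ^ α := by positivity
    calc _ ≤ e 2 / x * ((1 + |θ|) ^ α * (n:ℝ) ^ α) := by gcongr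
      _ ≤ _ := by nlinarith



/-! ### The normalized Sibuya weights -/

def qq (α : ℝ) (r : ℕ) : ℝ := if r = 0 then 0 else sibuya α r / α

lemma qq_zero (α : ℝ) : qq α 0 = 0 := by simp [qq]

lemma qq_one {α : ℝ} (hα0 : 0 < α) : qq α 1 = 1 := by
  simp [qq, sibuya, risingFactorial, hα0.ne']

lemma qq_succ {α : ℝ} (hα0 : 0 < α) (r : ℕ) :
    ((r:ℝ) - α) * qq α r = ((r:ℝ) + 1) * qq α (r+1) - if r = 0 then 1 else 0 := by
  rcases Nat.eq_zero_or_pos r with h | h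
  · subst h; simp [qq_zero, qq_one hα0]
  · obtain ⟨m, rfl⟩ : ∃ m, r = m + 1 := ⟨r - 1, by omega⟩
    have hf : (Nat.factorial (m+1) : ℝ) ≠ 0 := by positivity
    have hm : ((m:ℝ) + 1 + 1) ≠ 0 := by positivity
    simp only [qq, sibuya, Nat.add_sub_cancel, risingFactorial,
      Nat.factorial_succ (m+1), Nat.succ_ne_zero, if_false]
    push_cast
    field_simp
    ring

lemma qq_nonneg {α : ℝ} (hα0 : 0 < α) (hα1 : α < 1) (r : ℕ) : 0 ≤ qq α r := by
  induction r with
  | zero => simp [qq_zero]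
  | succ r ih =>
    rcases Nat.eq_zero_or_pos r with h | h
    · subst h; simp [qq_one hα0]
    · have h1 := qq_succ hα0 r
      rw [if_neg (by omega)] at h1
      have h2 : (1:ℝ) ≤ r := by exact_mod_cast h
      have h3 : 0 ≤ ((r:ℝ) + 1) * qq α (r+1) := by
        have := mul_nonneg (by linarith : (0:ℝ) ≤ r - α) ih
        linarith
      exact nonneg_of_mul_nonneg_right h3 (by positivity)

lemma qq_rpow {α : ℝ} (hα0 : 0 < α) (hα1 : α < 1) {r : ℕ} (hr : 1 ≤ r) :
    (r:ℝ) * qq α r * (r:ℝ) ^ α ≤ 1 := by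
  induction r, hr using Nat.le_induction with
  | base => simp [qq_one hα0]
  | succ r hr ih =>
    have h1 := qq_succ hα0 r
    rw [if_neg (by omega), sub_zero] at h1
    have hr0 : (0:ℝ) < r := by exact_mod_cast hr
    have hr1 : (1:ℝ) ≤ r := by exact_mod_cast hr
    have h3 : ((r + 1 : ℕ) : ℝ) = r * (1 + 1 / r) := by push_cast; field_simp
    have h2 : (1 + 1 / (r:ℝ)) ^ α ≤ 1 + α * (1 / r) :=
      rpow_one_add_le_one_add_mul_self (le_trans (by norm_num) (by positivity : (0:ℝ) ≤ 1 / (r:ℝ)))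
        hα0.le hα1.le
    have hq := qq_nonneg hα0 hα1 r
    have e1 : ((r + 1 : ℕ) : ℝ) * qq α (r+1) = (r - α) * qq α r := by rw [h1]; push_cast; ring
    rw [e1, h3, Real.mul_rpow hr0.le (by positivity)]
    have h4 : 0 < (r:ℝ) ^ α := Real.rpow_pos_of_pos hr0 _
    have h5 : 0 ≤ (r - α) * qq α r := mul_nonneg (by linarith) hq
    calc (r - α) * qq α r * ((r:ℝ) ^ α * (1 + 1 / (r:ℝ)) ^ α)
        ≤ (r - α) * qq α r * ((r:ℝ) ^ α * (1 + α * (1 / r))) := by gcongr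
      _ = (r * qq α r * (r:ℝ) ^ α) * (1 - (α / r) ^ 2) := by field_simp; ring
      _ ≤ (r * qq α r * (r:ℝ) ^ α) * 1 := by
          gcongr
          nlinarith [sq_nonneg (α / r)]
      _ ≤ 1 := by rw [mul_one]; exact ih

lemma qq_le {α : ℝ} (hα0 : 0 < α) (hα1 : α < 1) {r : ℕ} (hr : 1 ≤ r) :
    qq α r ≤ 1 / r := by
  have h := qq_rpow hα0 hα1 hr
  have hr0 : (0:ℝ) < r := by exact_mod_cast hr
  have h1 : 1 ≤ (r:ℝ) ^ α := Real.one_le_rpow (by exact_mod_cast hr) hα0.le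
  rw [le_div_iff₀ hr0]
  have := mul_nonneg hr0.le (qq_nonneg hα0 hα1 r)
  nlinarith

/-! ### Algebra of the second-order functional -/

def Uu (α : ℝ) (b : ℕ → ℝ) (J : ℝ) (r s : ℕ) : ℝ :=
  (b r - qq α r * J) * (b s - qq α s * J) - if r = s then b r else 0

def aa (α : ℝ) (r : ℕ) : ℝ := (if r = 1 then 1 else 0) - α * qq α r

lemma sum_shift {n : ℕ} {f : ℕ → ℝ} (h0 : f 0 = 0) {i : ℕ} (hi : i ≤ n) :
    ∑ t ∈ Finset.Icc 1 n, (if i = t then f t else 0) = f i := by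
  rw [Finset.sum_ite_eq]
  split_ifs with h
  · rfl
  · have : i = 0 := by simp at h; omega
    rw [this, h0]

lemma sum_shift2 {n : ℕ} {f : ℕ → ℝ} (h0 : f 0 = 0) {i j : ℕ} (hi : i ≤ n) :
    ∑ t ∈ Finset.Icc 1 n, (if i = t then (if j = t then f t else 0) else 0)
      = if i = j then f i else 0 := by
  have := sum_shift (f := fun t => if j = t then f t else 0) (by simp [h0]) hi
  rw [this]
  by_cases h : i = j
  · simp [h]
  · rw [if_neg h, if_neg (fun e => h e.symm)]

lemma grow_sum {α : ℝ} (hα0 : 0 < α) {n : ℕ} {b : ℕ → ℝ} (hb : b 0 = 0) (J : ℝ)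
    {r s : ℕ} (hr : r + 1 ≤ n) (hs : s + 1 ≤ n) :
    ∑ t ∈ Finset.Icc 1 n, ((t:ℝ) - α) * b t * Uu α (fun i => b i + cc t i) J (r+1) (s+1)
      = (∑ t ∈ Finset.Icc 1 n, ((t:ℝ) - α) * b t) * Uu α b J (r+1) (s+1)
        + (r - α) * Uu α b J r (s+1) + (s - α) * Uu α b J (r+1) s
        - ((r:ℝ) + 1 + (s + 1) - 2 * α) * Uu α b J (r+1) (s+1)
        - J * (aa α (r+1) * (b (s+1) - qq α (s+1) * J)
            + aa α (s+1) * (b (r+1) - qq α (r+1) * J)) := by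
  set f : ℕ → ℝ := fun t => ((t:ℝ) - α) * b t with hf
  have f0 : f 0 = 0 := by simp [hf, hb]
  set X := b (r+1) - qq α (r+1) * J with hX
  set Y := b (s+1) - qq α (s+1) * J with hY
  set V := Uu α b J (r+1) (s+1) with hV
  have e1 : ∀ t ∈ Finset.Icc 1 n,
      ((t:ℝ) - α) * b t * Uu α (fun i => b i + cc t i) J (r+1) (s+1)
      = f t * V + ((if r = t then f t else 0) - (if r + 1 = t then f t else 0)) * Y
        + ((if s = t then f t else 0) - (if s + 1 = t then f t else 0)) * X
        + ((if r = t then (if s = t then f t else 0) else 0)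
           - (if r = t then (if s + 1 = t then f t else 0) else 0)
           - (if r + 1 = t then (if s = t then f t else 0) else 0)
           + (if r + 1 = t then (if s + 1 = t then f t else 0) else 0))
        - (if r = s then 1 else 0)
          * ((if r = t then f t else 0) - (if r + 1 = t then f t else 0)) := by
    intro t _
    have c1 : ∀ i : ℕ, cc t (i+1) = (if i = t then 1 else 0) - (if i + 1 = t then 1 else 0) := by
      intro i; simp [cc]
    have c2 : ∀ (p : Prop) [Decidable p] (x : ℝ), (if p then x else 0) = (if p then 1 else 0) * x := by
      intro p _ x; split_ifs <;> simp
    rw [hV]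
    simp only [Uu, c1]
    simp only [Nat.add_right_cancel_iff]
    rw [c2 (r = t) (f t), c2 (r + 1 = t) (f t), c2 (s = t) (f t), c2 (s + 1 = t) (f t),
      c2 (r = t) (_ * f t), c2 (r = t) (_ * f t), c2 (r + 1 = t) (_ * f t),
      c2 (r + 1 = t) (_ * f t), c2 (r = s) (b (r+1)), c2 (r = s) (b (r + 1) + _)]
    simp only [hf, hX, hY]
    ring
  rw [Finset.sum_congr rfl e1]
  simp only [Finset.sum_add_distrib, Finset.sum_sub_distrib, ← Finset.sum_mul, ← Finset.mul_sum]
  rw [sum_shift f0 (by omega : r ≤ n), sum_shift f0 hr, sum_shift f0 (by omega : s ≤ n),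
    sum_shift f0 hs, sum_shift2 f0 (by omega : r ≤ n), sum_shift2 f0 (by omega : r ≤ n),
    sum_shift2 f0 hr, sum_shift2 f0 hr]
  have q1 := qq_succ hα0 r
  have q2 := qq_succ hα0 s
  have a1 : aa α (r+1) = ((r:ℝ) + 1 - α) * qq α (r+1) - (r - α) * qq α r := by
    rw [q1]; simp only [aa, Nat.add_eq_right]; ring
  have a2 : aa α (s+1) = ((s:ℝ) + 1 - α) * qq α (s+1) - (s - α) * qq α s := by
    rw [q2]; simp only [aa, Nat.add_eq_right]; ring
  rw [a1, a2]
  simp only [hV, hX, hY, hf, Uu, Nat.add_right_cancel_iff]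
  by_cases h1 : r = s
  · subst h1
    have n1 : ¬ (r = r + 1) := by omega
    have n2 : ¬ (r + 1 = r) := by omega
    simp only [n1, n2, if_true, if_false]
    push_cast
    ring
  · by_cases h2 : r = s + 1
    · subst h2
      have n1 : ¬ (s + 1 = s) := by omega
      have n2 : ¬ (s + 1 + 1 = s) := by omega
      simp only [n1, n2, if_true, if_false]
      push_cast
      ring
    · by_cases h3 : r + 1 = s
      · subst h3
        have n1 : ¬ (r = r + 1) := by omega
        have n2 : ¬ (r = r + 1 + 1) := by omega
        simp only [n1, n2, if_true, if_false]
        push_cast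
        ring
      · simp only [h1, h2, h3, if_false]
        push_cast
        ring

def ww (α θ : ℝ) (k : ℕ) : ℝ := if k ≤ 1 then 0 else 1 / (α * ((k:ℝ) - 1) + θ)

lemma ww_nonneg (hα0 : 0 < α) (hθ : 0 < α + θ) (k : ℕ) : 0 ≤ ww α θ k := by
  unfold ww
  split_ifs with h
  · exact le_rfl
  · have : (2:ℝ) ≤ k := by exact_mod_cast (by omega : 2 ≤ k)
    have : 0 < α * ((k:ℝ) - 1) + θ := by nlinarith
    positivity

lemma new_U {α : ℝ} (b : ℕ → ℝ) (J : ℝ) (r s : ℕ) :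
    Uu α (fun i => b i + if i = 1 then 1 else 0) (J + α) r s
      = (b r - qq α r * J + aa α r) * (b s - qq α s * J + aa α s)
        - if r = s then b r + (if r = 1 then 1 else 0) else 0 := by
  unfold Uu aa
  ring

lemma aa_src (hα0 : 0 < α) (hα1 : α < 1) (r s : ℕ) : aa α (r+1) * aa α (s+1)
        - (if r + 1 = s + 1 then (if r + 1 = 1 then 1 else 0) else 0)
        ≤ qq α (r+1) * qq α (s+1) := by
  have hq1 := qq_nonneg hα0 hα1 (r+1)
  have hq2 := qq_nonneg hα0 hα1 (s+1)
  have qone := qq_one hα0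
  unfold aa
  by_cases hr : r = 0
  · subst hr
    by_cases hs : s = 0
    · subst hs
      simp only [zero_add, qone, if_true]
      nlinarith
    · simp only [zero_add, qone, if_true]
      rw [if_neg (by omega : ¬ (s + 1 = 1)), if_neg (by omega : ¬ (1 = s + 1))]
      have := mul_nonneg hα0.le hq2
      have := mul_nonneg (sub_nonneg.2 hα1.le) this
      linarith
  · by_cases hs : s = 0
    · subst hs
      simp only [zero_add, qone, if_true]
      rw [if_neg (by omega : ¬ (r + 1 = 1))]
      have := mul_nonneg hα0.le hq1
      have := mul_nonneg (sub_nonneg.2 hα1.le) this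
      simp only [ite_self, hr]
      simp only [sub_zero, mul_one]
      linarith
    · rw [if_neg (by omega : ¬ (r + 1 = 1)), if_neg (by omega : ¬ (s + 1 = 1))]
      simp only [ite_self, sub_zero, zero_sub]
      have h2 : α ^ 2 ≤ 1 := by nlinarith
      have h3 := mul_le_of_le_one_left (mul_nonneg hq1 hq2) h2
      linarith

set_option maxHeartbeats 1000000 in
/-- pointwise drift inequality in the interior. -/
lemma key_pointwise (hα0 : 0 < α) (hα1 : α < 1) (hθ : 0 < α + θ)
    {n k : ℕ} {b : ℕ → ℝ} (hb : b 0 = 0) (hk : 1 ≤ k)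
    (hS : ∑ t ∈ Finset.Icc 1 n, ((t:ℝ) - α) * b t = n - α * k)
    {r s : ℕ} (hrn : r + 1 ≤ n) (hsn : s + 1 ≤ n)
    (h1 : k = 1 → b (r+1) = 0 ∧ b (s+1) = 0) :
    (α * k + θ) * (ww α θ (k+1) * Uu α (fun i => b i + if i = 1 then 1 else 0)
        (α * ((k:ℝ) - 1) + θ + α) (r+1) (s+1))
      + ∑ t ∈ Finset.Icc 1 n, ((t:ℝ) - α) * b t *
        (ww α θ k * Uu α (fun i => b i + cc t i) (α * ((k:ℝ) - 1) + θ) (r+1) (s+1))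
    ≤ (n + θ - ((r:ℝ) + 1 + (s + 1) - α)) *
        (ww α θ k * Uu α b (α * ((k:ℝ) - 1) + θ) (r+1) (s+1))
      + (r - α) * (ww α θ k * Uu α b (α * ((k:ℝ) - 1) + θ) r (s+1))
      + (s - α) * (ww α θ k * Uu α b (α * ((k:ℝ) - 1) + θ) (r+1) s)
      + (1 + (α + θ)) ^ 2 * (qq α (r+1) * qq α (s+1)) := by
  have hq1 := qq_nonneg hα0 hα1 (r+1)
  have hq2 := qq_nonneg hα0 hα1 (s+1)
  have hqq := mul_nonneg hq1 hq2
  have hk' : (1:ℝ) ≤ k := by exact_mod_cast hk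
  set J := α * ((k:ℝ) - 1) + θ with hJ
  have hJα : α * k + θ = J + α := by rw [hJ]; ring
  have hJα0 : 0 < J + α := by rw [← hJα]; nlinarith
  have hw1 : ww α θ (k+1) = 1 / (J + α) := by
    unfold ww
    rw [if_neg (by omega), ← hJα]; push_cast; ring_nf
  have e1 : (α * k + θ) * (ww α θ (k+1) * Uu α (fun i => b i + if i = 1 then 1 else 0)
        (J + α) (r+1) (s+1)) = Uu α (fun i => b i + if i = 1 then 1 else 0)
        (J + α) (r+1) (s+1) := by
    rw [hw1, hJα]; field_simp
  have e2 : ∑ t ∈ Finset.Icc 1 n, ((t:ℝ) - α) * b t *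
        (ww α θ k * Uu α (fun i => b i + cc t i) J (r+1) (s+1))
        = ww α θ k * ∑ t ∈ Finset.Icc 1 n, ((t:ℝ) - α) * b t *
        Uu α (fun i => b i + cc t i) J (r+1) (s+1) := by
    rw [Finset.mul_sum]; exact Finset.sum_congr rfl fun t _ => by ring
  rw [e1, e2, grow_sum hα0 hb J hrn hsn, new_U, hS]
  have qone := qq_one hα0
  rcases Nat.lt_or_ge k 2 with hlt | hge
  · have hk1 : k = 1 := by omega
    obtain ⟨b1, b2⟩ := h1 hk1
    have w0 : ww α θ k = 0 := by simp [ww, hk1]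
    have J0 : J = θ := by rw [hJ, hk1]; simp
    rw [w0, b1, b2, J0]
    simp only [zero_mul, mul_zero, add_zero, zero_add]
    have hx : ∀ m : ℕ, |0 - qq α (m+1) * θ + aa α (m+1)| ≤ (1 + (α + θ)) * qq α (m+1) := by
      intro m
      have hq := qq_nonneg hα0 hα1 (m+1)
      unfold aa
      rw [abs_le]
      by_cases hm : m = 0
      · subst hm; simp only [zero_add, qone, if_true]; constructor <;> linarith
      · rw [if_neg (by omega)]
        constructor <;> nlinarith
    have p := hx r
    have p' := hx s
    have h3 : (0 - qq α (r+1) * θ + aa α (r+1)) * (0 - qq α (s+1) * θ + aa α (s+1))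
        ≤ ((1 + (α + θ)) * qq α (r+1)) * ((1 + (α + θ)) * qq α (s+1)) := by
      refine (le_abs_self _).trans ?_
      rw [abs_mul]
      exact mul_le_mul p p' (abs_nonneg _) (by positivity)
    have h4 : (0:ℝ) ≤ if r + 1 = s + 1 then (if r + 1 = 1 then 1 else 0) else 0 := by
      split_ifs <;> norm_num
    calc _ ≤ (0 - qq α (r+1) * θ + aa α (r+1)) * (0 - qq α (s+1) * θ + aa α (s+1)) := by
          linarith
      _ ≤ _ := h3
      _ = _ := by ring
  · have hge' : (2:ℝ) ≤ k := by exact_mod_cast hge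
    have hJ0 : 0 < J := by rw [hJ]; nlinarith
    have w1 : ww α θ k = 1 / J := by unfold ww; rw [if_neg (by omega)]
    have hn : (n:ℝ) - α * k = (n + θ) - (J + α) := by rw [← hJα]; ring
    rw [w1, hn]
    have hsrc : aa α (r+1) * aa α (s+1)
        - (if r + 1 = s + 1 then (if r + 1 = 1 then 1 else 0) else 0)
        ≤ (1 + (α + θ)) ^ 2 * (qq α (r+1) * qq α (s+1)) := by
      refine (aa_src hα0 hα1 r s).trans ?_
      have : 1 ≤ (1 + (α + θ)) ^ 2 := by nlinarith
      exact le_mul_of_one_le_left hqq this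
    have hite : (if r + 1 = s + 1 then b (r+1) + (if r + 1 = 1 then (1:ℝ) else 0) else 0)
        = (if r + 1 = s + 1 then b (r+1) else 0)
          + (if r + 1 = s + 1 then (if r + 1 = 1 then 1 else 0) else 0) := by
      split_ifs <;> simp
    rw [hite]
    have hU : Uu α b J (r+1) (s+1) = (b (r+1) - qq α (r+1) * J) * (b (s+1) - qq α (s+1) * J)
        - (if r + 1 = s + 1 then b (r+1) else 0) := rfl
    generalize (if r + 1 = s + 1 then (if r + 1 = 1 then (1:ℝ) else 0) else 0) = d at *
    generalize (if r + 1 = s + 1 then b (r+1) else 0) = d' at *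
    generalize (b (r+1) - qq α (r+1) * J) = X at *
    generalize (b (s+1) - qq α (s+1) * J) = Y at *
    have hd : d' = X * Y - Uu α b J (r+1) (s+1) := by rw [hU]; ring
    rw [hd]
    generalize Uu α b J (r+1) (s+1) = V at *
    generalize Uu α b J r (s+1) = V1 at *
    generalize Uu α b J (r+1) s = V2 at *
    generalize aa α (r+1) = a1 at *
    generalize aa α (s+1) = a2 at *
    refine le_trans (le_of_eq ?_) (add_le_add_right hsrc _)
    field_simp
    ring



/-! ### The expected second-order functional -/

def bb (b : ℕ → ℕ) (r : ℕ) : ℝ := if r = 0 then 0 else (b r : ℝ)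

lemma bb_zero (b : ℕ → ℕ) : bb b 0 = 0 := by simp [bb]
lemma bb_succ (b : ℕ → ℕ) (r : ℕ) : bb b (r+1) = (b (r+1) : ℝ) := by simp [bb]

lemma Uu_zero_left (b : ℕ → ℕ) (J : ℝ) (s : ℕ) : Uu α (bb b) J 0 s = 0 := by
  simp [Uu, bb_zero, qq_zero]
lemma Uu_zero_right (b : ℕ → ℕ) (J : ℝ) (s : ℕ) : Uu α (bb b) J s 0 = 0 := by
  simp only [Uu, bb_zero, qq_zero]
  split_ifs with h
  · subst h; simp [bb_zero]
  · simp

def uu (α θ : ℝ) {Ω : Type*} {mΩ : MeasurableSpace Ω}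
    (μ : Measure Ω) (K : ℕ → Ω → ℕ) (B : ℕ → ℕ → Ω → ℕ) (n r s : ℕ) : ℝ :=
  ∫ ω, ww α θ (K n ω) * Uu α (bb (fun i => B i n ω)) (α * ((K n ω : ℝ) - 1) + θ) r s ∂μ

lemma uu_int (h : IsEwensPitman α θ μ F K B) {n : ℕ} (hn : 1 ≤ n) (r s : ℕ) :
    Integrable (fun ω => ww α θ (K n ω) *
      Uu α (bb (fun i => B i n ω)) (α * ((K n ω : ℝ) - 1) + θ) r s) μ := by
  rcases r with _ | r
  · simp [Uu_zero_left]
  rcases s with _ | s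
  · simp [Uu_zero_right]
  have := fn_int h hn (show 1 ≤ r + 1 by omega) (show 1 ≤ s + 1 by omega)
    (fun k x y => ww α θ k * (((x:ℝ) - qq α (r+1) * (α * ((k : ℝ) - 1) + θ)) *
      ((y:ℝ) - qq α (s+1) * (α * ((k : ℝ) - 1) + θ)) - if r + 1 = s + 1 then (x:ℝ) else 0))
  simpa only [Uu, bb_succ] using this

lemma uu_zero_left (n s : ℕ) : uu α θ μ K B n 0 s = 0 := by simp [uu, Uu_zero_left]
lemma uu_zero_right (n s : ℕ) : uu α θ μ K B n s 0 = 0 := by simp [uu, Uu_zero_right]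

lemma int4 [IsProbabilityMeasure μ] {f g k : Ω → ℝ} (hf : Integrable f μ) (hg : Integrable g μ)
    (hk : Integrable k μ) (a b c d : ℝ) :
    ∫ ω, (a * f ω + b * g ω + c * k ω + d) ∂μ
      = a * ∫ ω, f ω ∂μ + b * ∫ ω, g ω ∂μ + c * ∫ ω, k ω ∂μ + d := by
  have i1 := hf.const_mul a
  have i2 := hg.const_mul b
  have i3 := hk.const_mul c
  have i12 : Integrable (fun ω => a * f ω + b * g ω) μ := i1.add i2
  have i123 : Integrable (fun ω => a * f ω + b * g ω + c * k ω) μ := i12.add i3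
  rw [integral_add i123 (integrable_const _), integral_add i12 i3, integral_add i1 i2]
  simp only [integral_const_mul, integral_const, probReal_univ, smul_eq_mul, one_mul]

lemma uu_rec (h : IsEwensPitman α θ μ F K B) (hα0 : 0 < α) (hα1 : α < 1)
    (hθ : 0 < α + θ) {n : ℕ} (hn : 1 ≤ n) {r s : ℕ} (hrs : r + 1 + (s + 1) ≤ n) :
    uu α θ μ K B (n+1) (r+1) (s+1) ≤
      ((n + θ - ((r:ℝ) + 1 + (s + 1) - α)) * uu α θ μ K B n (r+1) (s+1)
      + (r - α) * uu α θ μ K B n r (s+1) + (s - α) * uu α θ μ K B n (r+1) s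
      + (1 + (α + θ)) ^ 2 * (qq α (r+1) * qq α (s+1))) / (n + θ) := by
  have hprob := h.prob
  have hn' : (1:ℝ) ≤ n := by exact_mod_cast hn
  have hpos : 0 < (n:ℝ) + θ := by linarith
  have hr1 : 1 ≤ r + 1 := by omega
  have hs1 : 1 ≤ s + 1 := by omega
  set f0 : ℕ → ℕ → ℕ → ℝ := fun k x y => ww α θ (k+1) *
    ((((x:ℝ) + if r + 1 = 1 then 1 else 0) - qq α (r+1) * (α * ((k : ℝ) - 1) + θ + α)) *
      (((y:ℝ) + if s + 1 = 1 then 1 else 0) - qq α (s+1) * (α * ((k : ℝ) - 1) + θ + α))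
        - if r + 1 = s + 1 then ((x:ℝ) + if r + 1 = 1 then 1 else 0) else 0) with hf0
  set ft : ℕ → ℕ → ℕ → ℕ → ℝ := fun t k x y => ww α θ k *
    ((((x:ℝ) + cc t (r+1)) - qq α (r+1) * (α * ((k : ℝ) - 1) + θ)) *
      (((y:ℝ) + cc t (s+1)) - qq α (s+1) * (α * ((k : ℝ) - 1) + θ))
        - if r + 1 = s + 1 then ((x:ℝ) + cc t (r+1)) else 0) with hft
  have st := step h hα1 hθ hn (X := fun ω => ww α θ (K (n+1) ω) *
      Uu α (bb (fun i => B i (n+1) ω)) (α * ((K (n+1) ω : ℝ) - 1) + θ) (r+1) (s+1))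
    (Y0 := fun ω => f0 (K n ω) (B (r+1) n ω) (B (s+1) n ω))
    (Y := fun t ω => ft t (K n ω) (B (r+1) n ω) (B (s+1) n ω))
    (fn_meas h n (r+1) (s+1) f0)
    (fun t => fn_meas h n (r+1) (s+1) (ft t))
    (fn_bdd h hn hr1 hs1 f0)
    (fun t => fn_bdd h hn hr1 hs1 (ft t))
    (Eventually.of_forall fun ω hω => by
      simp only [Uu, bb_succ, hf0]
      rw [newSet_B hω hr1, newSet_B hω hs1, hω.1]
      push_cast
      ring_nf)
    (fun t _ => Eventually.of_forall fun ω hω => by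
      simp only [Uu, bb_succ, hft]
      rw [growSet_B hω hr1, growSet_B hω hs1, hω.1])
  unfold uu
  rw [st.2]
  have i1 := uu_int h hn (r+1) (s+1)
  have i2 := uu_int h hn r (s+1)
  have i3 := uu_int h hn (r+1) s
  have key : ∀ᵐ ω ∂μ, ((α * K n ω + θ) * f0 (K n ω) (B (r+1) n ω) (B (s+1) n ω)
      + ∑ t ∈ Finset.Icc 1 n, ((t:ℝ) - α) * B t n ω *
        ft t (K n ω) (B (r+1) n ω) (B (s+1) n ω)) / ((n:ℝ) + θ) ≤
      ((n + θ - ((r:ℝ) + 1 + (s + 1) - α)) * (ww α θ (K n ω) *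
        Uu α (bb (fun i => B i n ω)) (α * ((K n ω : ℝ) - 1) + θ) (r+1) (s+1))
      + (r - α) * (ww α θ (K n ω) *
        Uu α (bb (fun i => B i n ω)) (α * ((K n ω : ℝ) - 1) + θ) r (s+1))
      + (s - α) * (ww α θ (K n ω) *
        Uu α (bb (fun i => B i n ω)) (α * ((K n ω : ℝ) - 1) + θ) (r+1) s)
      + (1 + (α + θ)) ^ 2 * (qq α (r+1) * qq α (s+1))) / (n + θ) := by
    filter_upwards [h.good hn] with ω hg
    refine div_le_div_of_nonneg_right ?_ hpos.le
    have hS : ∑ t ∈ Finset.Icc 1 n, ((t:ℝ) - α) * bb (fun i => B i n ω) t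
        = n - α * (K n ω : ℝ) := by
      rw [← hg.sum_rate α]
      refine Finset.sum_congr rfl fun t ht => ?_
      have := (Finset.mem_Icc.1 ht).1
      rw [bb, if_neg (by omega)]
    have kp := key_pointwise hα0 hα1 hθ (n := n) (k := K n ω) (b := bb (fun i => B i n ω))
      (bb_zero _) (hg.pos hn) hS (r := r) (s := s) (by omega) (by omega)
      (by
        intro h1
        have hg' := hg
        rw [h1] at hg'
        rw [bb_succ, bb_succ]
        exact ⟨by exact_mod_cast hg'.one hr1 (by omega), by exact_mod_cast hg'.one hs1 (by omega)⟩)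
    refine le_trans (le_of_eq ?_) kp
    congr 1
    simp only [Uu, bb_succ]
    · refine Finset.sum_congr rfl fun t ht => ?_
      have := (Finset.mem_Icc.1 ht).1
      have e : bb (fun i => B i n ω) t = B t n ω := by rw [bb, if_neg (by omega)]
      simp only [hft, e]
  have I : Integrable (fun ω => ((n + θ - ((r:ℝ) + 1 + (s + 1) - α)) * (ww α θ (K n ω) *
        Uu α (bb (fun i => B i n ω)) (α * ((K n ω : ℝ) - 1) + θ) (r+1) (s+1))
      + (r - α) * (ww α θ (K n ω) *
        Uu α (bb (fun i => B i n ω)) (α * ((K n ω : ℝ) - 1) + θ) r (s+1))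
      + (s - α) * (ww α θ (K n ω) *
        Uu α (bb (fun i => B i n ω)) (α * ((K n ω : ℝ) - 1) + θ) (r+1) s)
      + (1 + (α + θ)) ^ 2 * (qq α (r+1) * qq α (s+1))) / ((n:ℝ) + θ)) μ :=
    (((((i1.const_mul _).add (i2.const_mul _)).add (i3.const_mul _)).add
      (integrable_const _)).div_const _)
  refine (integral_mono_ae st.1 I key).trans (le_of_eq ?_)
  rw [integral_div]
  congr 1
  exact int4 i1 i2 i3 _ _ _ _


/-! ### Boundary estimates -/

def HH (b : ℕ → ℕ) (r s : ℕ) : ℝ := bb b r * bb b s - if r = s then bb b r else 0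

lemma bb_nonneg (b : ℕ → ℕ) (r : ℕ) : 0 ≤ bb b r := by
  unfold bb; split_ifs <;> positivity

lemma HH_zero_left (b : ℕ → ℕ) (s : ℕ) : HH b 0 s = 0 := by simp [HH, bb_zero]
lemma HH_zero_right (b : ℕ → ℕ) (s : ℕ) : HH b s 0 = 0 := by
  simp only [HH, bb_zero]
  split_ifs with h
  · subst h; simp [bb_zero]
  · simp

lemma HH_nonneg (b : ℕ → ℕ) (r s : ℕ) : 0 ≤ HH b r s := by
  unfold HH
  split_ifs with h
  · subst h
    unfold bb
    split_ifs
    · simp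
    · rcases Nat.eq_zero_or_pos (b r) with h0 | h0
      · simp [h0]
      · have : (1:ℝ) ≤ b r := by exact_mod_cast h0
        nlinarith
  · have := mul_nonneg (bb_nonneg b r) (bb_nonneg b s)
    linarith

lemma HH_le (b : ℕ → ℕ) (r s : ℕ) : HH b r s ≤ bb b r * bb b s := by
  unfold HH
  have := bb_nonneg b r
  split_ifs <;> linarith

lemma HH_eq_nat (b : ℕ → ℕ) {r s : ℕ} (hr : 1 ≤ r) (hs : 1 ≤ s) :
    HH b r s = ((b r * b s - (if r = s then b r else 0) : ℕ) : ℝ) := by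
  unfold HH bb
  rw [if_neg (by omega), if_neg (by omega)]
  split_ifs with h
  · subst h
    rw [Nat.cast_sub (Nat.le_mul_self _)]
    push_cast; ring
  · simp

lemma GoodState.HH_out {n k : ℕ} {b : ℕ → ℕ} (h : GoodState n k b) {r s : ℕ} (hr : 1 ≤ r)
    (hs : 1 ≤ s) (hrs : n < r + s) : HH b r s = 0 := by
  rw [HH_eq_nat b hr hs]
  norm_cast
  by_cases hrn : n < r
  · simp [h.hz r hrn]
  by_cases hsn : n < s
  · have := h.hz s hsn
    split_ifs with e
    · subst e; simp [this]
    · simp [this]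
  have hmr : r ∈ Finset.Icc 1 n := Finset.mem_Icc.2 ⟨hr, by omega⟩
  have hms : s ∈ Finset.Icc 1 n := Finset.mem_Icc.2 ⟨hs, by omega⟩
  have h3 := h.hn
  by_cases e : r = s
  · subst e
    rw [if_pos rfl]
    have h4 : r * b r ≤ n := by
      conv_rhs => rw [h3]
      exact Finset.single_le_sum (f := fun r => r * b r) (fun _ _ => Nat.zero_le _) hmr
    have : b r ≤ 1 := by
      by_contra hc
      have : r * 2 ≤ r * b r := Nat.mul_le_mul_left _ (by omega)
      omega
    interval_cases (b r) <;> simp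
  · rw [if_neg e]
    have h4 : r * b r + s * b s ≤ n := by
      conv_rhs => rw [h3]
      rw [← Finset.sum_pair (f := fun r => r * b r) e]
      refine Finset.sum_le_sum_of_subset ?_
      intro x hx
      simp only [Finset.mem_insert, Finset.mem_singleton] at hx
      rcases hx with rfl | rfl <;> assumption
    simp only [Nat.sub_zero, Nat.mul_eq_zero]
    by_contra hc
    push Not at hc
    have : r * 1 ≤ r * b r := Nat.mul_le_mul_left _ (by omega)
    have : s * 1 ≤ s * b s := Nat.mul_le_mul_left _ (by omega)
    omega

lemma ww_U_le (hα0 : 0 < α) (hα1 : α < 1) (hθ : 0 < α + θ) {k : ℕ} (hk : 1 ≤ k) (b : ℕ → ℕ)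
    (r s : ℕ) :
    ww α θ k * Uu α (bb b) (α * ((k:ℝ) - 1) + θ) r s
      ≤ ww α θ k * HH b r s + qq α r * qq α s * (α * k + θ) := by
  have hq1 := qq_nonneg hα0 hα1 r
  have hq2 := qq_nonneg hα0 hα1 s
  have hqq := mul_nonneg hq1 hq2
  have hk' : (1:ℝ) ≤ k := by exact_mod_cast hk
  have hp : 0 < α * k + θ := by nlinarith
  rcases Nat.lt_or_ge k 2 with hlt | hge
  · have : ww α θ k = 0 := by unfold ww; rw [if_pos (by omega)]
    rw [this]
    have := mul_nonneg hqq hp.le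
    linarith
  · have hge' : (2:ℝ) ≤ k := by exact_mod_cast hge
    have hJ0 : 0 < α * ((k:ℝ) - 1) + θ := by nlinarith
    have w1 : ww α θ k = 1 / (α * ((k:ℝ) - 1) + θ) := by unfold ww; rw [if_neg (by omega)]
    have hJ : α * k + θ = (α * ((k:ℝ) - 1) + θ) + α := by ring
    rw [hJ, w1]
    set J := α * ((k:ℝ) - 1) + θ
    have h1 : Uu α (bb b) J r s ≤ HH b r s + qq α r * qq α s * J * J := by
      unfold Uu HH
      have := mul_nonneg (mul_nonneg (bb_nonneg b r) hq2) hJ0.le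
      have := mul_nonneg (mul_nonneg (bb_nonneg b s) hq1) hJ0.le
      linarith
    calc 1 / J * Uu α (bb b) J r s ≤ 1 / J * (HH b r s + qq α r * qq α s * J * J) := by
          gcongr
      _ = 1 / J * HH b r s + qq α r * qq α s * J := by field_simp
      _ ≤ _ := by
          have := mul_nonneg hqq hα0.le
          linarith

def hh (α θ : ℝ) {Ω : Type*} {mΩ : MeasurableSpace Ω}
    (μ : Measure Ω) (K : ℕ → Ω → ℕ) (B : ℕ → ℕ → Ω → ℕ) (n r s : ℕ) : ℝ :=
  ∫ ω, ww α θ (K n ω) * HH (fun i => B i n ω) r s ∂μ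

lemma hh_int (h : IsEwensPitman α θ μ F K B) {n : ℕ} (hn : 1 ≤ n) (r s : ℕ) :
    Integrable (fun ω => ww α θ (K n ω) * HH (fun i => B i n ω) r s) μ := by
  rcases r with _ | r
  · simp [HH_zero_left]
  rcases s with _ | s
  · simp [HH_zero_right]
  have := fn_int h hn (show 1 ≤ r + 1 by omega) (show 1 ≤ s + 1 by omega)
    (fun k x y => ww α θ k * ((x:ℝ) * (y:ℝ) - if r + 1 = s + 1 then (x:ℝ) else 0))
  simpa only [HH, bb_succ] using this

lemma hh_nonneg (hα0 : 0 < α) (hθ : 0 < α + θ) (n r s : ℕ) : 0 ≤ hh α θ μ K B n r s :=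
  integral_nonneg fun ω => mul_nonneg (ww_nonneg hα0 hθ _) (HH_nonneg _ _ _)

lemma hh_out (h : IsEwensPitman α θ μ F K B) {n r s : ℕ} (hn : 1 ≤ n) (hr : 1 ≤ r)
    (hs : 1 ≤ s) (hrs : n < r + s) : hh α θ μ K B n r s = 0 := by
  unfold hh
  rw [← integral_zero Ω ℝ (μ := μ)]
  refine integral_congr_ae ?_
  filter_upwards [h.good hn] with ω hg
  rw [hg.HH_out hr hs hrs, mul_zero]

lemma qq_half (hα0 : 0 < α) (hα1 : α < 1) {n r s : ℕ} (hr : 1 ≤ r) (hs : 1 ≤ s)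
    (hrn : n ≤ 2 * r) : qq α r * qq α s * (n:ℝ) ^ α ≤ 2 / (r * s) := by
  have hr0 : (0:ℝ) < r := by exact_mod_cast hr
  have hs0 : (0:ℝ) < s := by exact_mod_cast hs
  have h1 := qq_rpow hα0 hα1 hr
  have h2 := qq_le hα0 hα1 hs
  have hq1 := qq_nonneg hα0 hα1 r
  have hq2 := qq_nonneg hα0 hα1 s
  have h3 : (n:ℝ) ^ α ≤ 2 * (r:ℝ) ^ α := by
    have : (n:ℝ) ≤ 2 * r := by exact_mod_cast hrn
    calc (n:ℝ) ^ α ≤ (2 * r) ^ α := Real.rpow_le_rpow (by positivity) this hα0.le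
      _ = 2 ^ α * (r:ℝ) ^ α := Real.mul_rpow (by norm_num) hr0.le
      _ ≤ 2 ^ (1:ℝ) * (r:ℝ) ^ α := by
          gcongr
          norm_num
      _ = _ := by rw [Real.rpow_one]
  have h4 : qq α r * (r:ℝ) ^ α ≤ 1 / r := by
    rw [le_div_iff₀ hr0]; linarith
  calc qq α r * qq α s * (n:ℝ) ^ α ≤ qq α r * qq α s * (2 * (r:ℝ) ^ α) := by gcongr
    _ = 2 * (qq α r * (r:ℝ) ^ α) * qq α s := by ring
    _ ≤ 2 * (1 / r) * (1 / s) := by gcongr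
    _ = _ := by field_simp

lemma uu_boundary (h : IsEwensPitman α θ μ F K B) (hα0 : 0 < α) (hα1 : α < 1)
    (hθ : 0 < α + θ) : ∃ C, 0 ≤ C ∧ ∀ n r s : ℕ, 1 ≤ n → 1 ≤ r → 1 ≤ s → n ≤ r + s →
      uu α θ μ K B n r s ≤ hh α θ μ K B n r s + C / (r * s) := by
  obtain ⟨C, hC, hE⟩ := EK_bound h hα0 hα1 hθ
  refine ⟨C * 2, by positivity, fun n r s hn hr hs hrs => ?_⟩
  have hprob := h.prob
  have hq1 := qq_nonneg hα0 hα1 r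
  have hq2 := qq_nonneg hα0 hα1 s
  have hqq := mul_nonneg hq1 hq2
  have iK : Integrable (fun ω => α * (K n ω : ℝ) + θ) μ :=
    fn_int h hn le_rfl le_rfl (fun k _ _ => α * (k:ℝ) + θ)
  have i1 := hh_int h hn r s
  have h1 : uu α θ μ K B n r s ≤ ∫ ω, (ww α θ (K n ω) * HH (fun i => B i n ω) r s
      + qq α r * qq α s * (α * K n ω + θ)) ∂μ := by
    refine integral_mono_ae (uu_int h hn r s) (i1.add (iK.const_mul _)) ?_
    filter_upwards [h.good hn] with ω hg
    exact ww_U_le hα0 hα1 hθ (hg.pos hn) _ r s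
  rw [integral_add i1 (iK.const_mul _), integral_const_mul] at h1
  have h2 : qq α r * qq α s * (n:ℝ) ^ α ≤ 2 / (r * s) := by
    by_cases hc : n ≤ 2 * r
    · exact qq_half hα0 hα1 hr hs hc
    · have := qq_half hα0 hα1 hs hr (by omega : n ≤ 2 * s)
      rw [mul_comm (qq α r), mul_comm (r:ℝ)]; exact this
  refine h1.trans ?_
  unfold hh
  gcongr
  calc qq α r * qq α s * ∫ ω, (α * (K n ω : ℝ) + θ) ∂μ ≤ qq α r * qq α s * (C * (n:ℝ) ^ α) := by
        gcongr; exact hE n hn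
    _ = C * (qq α r * qq α s * (n:ℝ) ^ α) := by ring
    _ ≤ C * (2 / (r * s)) := by gcongr
    _ = _ := by ring

lemma Gs_ge {β : ℝ} (hβ1 : β ≤ 1) {n k : ℕ} {b : ℕ → ℕ} (h : GoodState n k b) (hn : 1 ≤ n) :
    (n:ℝ) ^ β ≤ Gs β n b := by
  have hn0 : (0:ℝ) < n := by exact_mod_cast hn
  have e : (n:ℝ) ^ β = ∑ r ∈ Finset.Icc 1 n, (n:ℝ) ^ (β - 1) * ((r:ℝ) * b r) := by
    rw [← Finset.mul_sum]
    have : ∑ r ∈ Finset.Icc 1 n, ((r:ℝ) * b r) = n := by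
      conv_rhs => rw [h.hn]
      push_cast; rfl
    rw [this, Real.rpow_sub_one hn0.ne']
    field_simp
  rw [e, Gs]
  refine Finset.sum_le_sum fun r hr => ?_
  rw [Finset.mem_Icc] at hr
  have hr0 : (0:ℝ) < r := by exact_mod_cast hr.1
  have h1 : (n:ℝ) ^ (β - 1) ≤ (r:ℝ) ^ (β - 1) :=
    Real.rpow_le_rpow_of_nonpos hr0 (by exact_mod_cast hr.2) (by linarith)
  have h2 : (r:ℝ) ^ β = (r:ℝ) ^ (β - 1) * r := by
    rw [Real.rpow_sub_one hr0.ne']; field_simp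
  rw [h2, ← mul_assoc]
  gcongr

lemma hh_diag (h : IsEwensPitman α θ μ F K B) (hα0 : 0 < α) (hα1 : α < 1)
    (hθ : 0 < α + θ) {β : ℝ} (hβ0 : 0 < β) (hβ1 : β ≤ 1) (hβα : 2 * β ≤ α)
    (hβθ : 4 * β ≤ α + θ) {n : ℕ} (hn : 1 ≤ n) :
    ∑ p ∈ Finset.HasAntidiagonal.antidiagonal n, hh α θ μ K B n p.1 p.2
      ≤ 8 / (α + θ) * (1 + (α + |θ|) / β) * (n:ℝ) ^ (-β) := by
  obtain ⟨iG, bG⟩ := G_bound h hα0 hα1 hθ hβ0 hβ1 hβα hβθ hn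
  have hn0 : (0:ℝ) < n := by exact_mod_cast hn
  have hnb : 0 < (n:ℝ) ^ (-β) := Real.rpow_pos_of_pos hn0 _
  unfold hh
  rw [← integral_finsetSum _ fun p _ => hh_int h hn p.1 p.2]
  have key : ∀ᵐ ω ∂μ, ∑ p ∈ Finset.HasAntidiagonal.antidiagonal n,
      ww α θ (K n ω) * HH (fun i => B i n ω) p.1 p.2
      ≤ (8 / (α + θ) * (n:ℝ) ^ (-β)) * (Gs β n (fun r => B r n ω) / (K n ω : ℝ)) := by
    filter_upwards [h.good hn] with ω hg
    have hG := Gs_nonneg β n (fun r => B r n ω)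
    by_cases h2 : K n ω = 2
    · have w2 : ww α θ (K n ω) = 1 / (α + θ) := by
        rw [h2]; unfold ww; norm_num
      have hs : ∑ p ∈ Finset.HasAntidiagonal.antidiagonal n, HH (fun i => B i n ω) p.1 p.2 ≤ 4 := by
        have hb2 : ∀ s, bb (fun i => B i n ω) s ≤ 2 := by
          intro s
          unfold bb
          split_ifs with hs
          · norm_num
          · have := hg.b_le (r := s) (by omega)
            rw [h2] at this
            exact_mod_cast this
        calc _ ≤ ∑ p ∈ Finset.HasAntidiagonal.antidiagonal n, bb (fun i => B i n ω) p.1 * 2 := by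
              refine Finset.sum_le_sum fun p _ => (HH_le _ _ _).trans ?_
              exact mul_le_mul_of_nonneg_left (hb2 _) (bb_nonneg _ _)
          _ = (∑ r ∈ Finset.Icc 1 n, (B r n ω : ℝ)) * 2 := by
              rw [← Finset.sum_mul]
              congr 1
              rw [Finset.Nat.sum_antidiagonal_eq_sum_range_succ_mk, Finset.sum_range_succ']
              simp only [bb_zero, add_zero, bb_succ]
              rw [Finset.range_eq_Ico, Finset.sum_Ico_add' (fun r => (B r n ω : ℝ)) 0 n 1]
              rfl
          _ = 4 := by
              have := hg.hk
              rw [h2] at this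
              have : (2:ℝ) = ∑ r ∈ Finset.Icc 1 n, (B r n ω : ℝ) := by exact_mod_cast this
              rw [← this]; norm_num
      have hge := Gs_ge hβ1 hg hn
      rw [← Finset.mul_sum, w2, h2]
      have e1 : (n:ℝ) ^ (-β) * (n:ℝ) ^ β = 1 := by
        rw [← Real.rpow_add hn0]; simp
      calc 1 / (α + θ) * _ ≤ 1 / (α + θ) * 4 := by gcongr
        _ = (8 / (α + θ)) * ((n:ℝ) ^ (-β) * (n:ℝ) ^ β) / 2 := by rw [e1]; ring
        _ = (8 / (α + θ) * (n:ℝ) ^ (-β)) * ((n:ℝ) ^ β / 2) := by ring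
        _ ≤ _ := by push_cast; gcongr
    · rw [Finset.sum_eq_zero]
      · positivity
      · intro p hp
        rw [Finset.HasAntidiagonal.mem_antidiagonal] at hp
        rcases Nat.eq_zero_or_pos p.1 with h0 | h0
        · rw [h0, HH_zero_left, mul_zero]
        rcases Nat.eq_zero_or_pos p.2 with h1 | h1
        · rw [h1, HH_zero_right, mul_zero]
        have : HH (fun i => B i n ω) p.1 p.2 = 0 := by
          rw [HH_eq_nat _ h0 h1]
          by_contra hc
          exact h2 (hg.two h0 h1 hp (by exact_mod_cast hc))
        rw [this, mul_zero]
  refine (integral_mono_ae (integrable_finsetSum _ fun p _ => hh_int h hn p.1 p.2)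
    (iG.const_mul _) key).trans ?_
  rw [integral_const_mul]
  calc _ ≤ (8 / (α + θ) * (n:ℝ) ^ (-β)) * (1 + (α + |θ|) / β) := by gcongr
    _ = _ := by ring


/-! ### Summation along antidiagonals -/

def yy (D : ℕ → ℕ → ℕ → ℝ) (n k : ℕ) : ℝ :=
  ∑ p ∈ Finset.HasAntidiagonal.antidiagonal k, D n p.1 p.2

lemma yy_nonneg {D : ℕ → ℕ → ℕ → ℝ} (D0 : ∀ n r s, 0 ≤ D n r s) (n k : ℕ) : 0 ≤ yy D n k :=
  Finset.sum_nonneg fun _ _ => D0 _ _ _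

lemma yy_rec {D : ℕ → ℕ → ℕ → ℝ} (Dl : ∀ n s, D n 0 s = 0)
    (Dr : ∀ n r, D n r 0 = 0) {n : ℕ}
    (Drec : ∀ r s, r + s ≤ n → D (n+1) r s ≤ ((n + θ - ((r:ℝ) + s - α)) * D n r s
      + ((r:ℝ) - 1 - α) * D n (r-1) s + ((s:ℝ) - 1 - α) * D n r (s-1)) / (n + θ))
    {k : ℕ} (hk : k + 1 ≤ n) :
    yy D (n+1) (k+1) ≤ ((n + θ - ((k:ℝ) + 1 - α)) * yy D n (k+1)
      + ((k:ℝ) - 2 * α) * yy D n k) / (n + θ) := by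
  have h1 : yy D (n+1) (k+1) ≤ ∑ p ∈ Finset.HasAntidiagonal.antidiagonal (k+1),
      ((n + θ - ((k:ℝ) + 1 - α)) * D n p.1 p.2
      + ((p.1:ℝ) - 1 - α) * D n (p.1-1) p.2 + ((p.2:ℝ) - 1 - α) * D n p.1 (p.2-1)) / (n + θ) := by
    refine Finset.sum_le_sum fun p hp => ?_
    rw [Finset.HasAntidiagonal.mem_antidiagonal] at hp
    refine (Drec p.1 p.2 (by omega)).trans (le_of_eq ?_)
    have : (p.1:ℝ) + p.2 = k + 1 := by exact_mod_cast hp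
    rw [this]
  refine h1.trans (le_of_eq ?_)
  rw [← Finset.sum_div]
  congr 1
  rw [Finset.sum_add_distrib, Finset.sum_add_distrib, ← Finset.mul_sum, add_assoc]
  congr 1
  rw [Finset.Nat.sum_antidiagonal_succ (f := fun p => ((p.1:ℝ) - 1 - α) * D n (p.1-1) p.2),
    Finset.Nat.sum_antidiagonal_succ' (f := fun p => ((p.2:ℝ) - 1 - α) * D n p.1 (p.2-1))]
  simp only [Nat.zero_sub, Dl, Dr, mul_zero, zero_add, add_zero, Nat.add_sub_cancel]
  rw [← Finset.sum_add_distrib, yy, Finset.mul_sum]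
  refine Finset.sum_congr rfl fun p hp => ?_
  rw [Finset.HasAntidiagonal.mem_antidiagonal] at hp
  have : (k:ℝ) = p.1 + p.2 := by exact_mod_cast hp.symm
  rw [this]
  push_cast
  ring

lemma zz_rec {D : ℕ → ℕ → ℕ → ℝ} (Dl : ∀ n s, D n 0 s = 0)
    (Dr : ∀ n r, D n r 0 = 0) {n : ℕ} (hpos : 0 < (n:ℝ) + θ) (D0 : ∀ n r s, 0 ≤ D n r s)
    (hα0 : 0 < α)
    (Drec : ∀ r s, r + s ≤ n → D (n+1) r s ≤ ((n + θ - ((r:ℝ) + s - α)) * D n r s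
      + ((r:ℝ) - 1 - α) * D n (r-1) s + ((s:ℝ) - 1 - α) * D n r (s-1)) / (n + θ)) :
    ∑ k ∈ Finset.range (n+1), yy D (n+1) k ≤
      (1 - α / (n + θ)) * ∑ k ∈ Finset.range n, yy D n k + (α + θ) / (n + θ) * yy D n n := by
  have y0 : ∀ m, yy D m 0 = 0 := fun m => by simp [yy, Dl]
  rw [Finset.sum_range_succ', y0, add_zero]
  have h1 : ∑ k ∈ Finset.range n, yy D (n+1) (k+1) ≤ ∑ k ∈ Finset.range n,
      ((n + θ - (((k+1 : ℕ):ℝ) - α)) * yy D n (k+1)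
      + ((k:ℝ) - 2 * α) * yy D n k) / (n + θ) := by
    refine Finset.sum_le_sum fun k hk => ?_
    rw [Finset.mem_range] at hk
    refine (yy_rec Dl Dr Drec (by omega)).trans (le_of_eq ?_)
    push_cast; ring
  refine h1.trans (le_of_eq ?_)
  rw [← Finset.sum_div, Finset.sum_add_distrib]
  have h2 : ∑ k ∈ Finset.range n, (n + θ - (((k+1 : ℕ):ℝ) - α)) * yy D n (k+1)
      = ∑ k ∈ Finset.range n, (n + θ - ((k:ℝ) - α)) * yy D n k + (α + θ) * yy D n n := by
    have e1 := Finset.sum_range_succ' (fun k : ℕ => (n + θ - ((k:ℝ) - α)) * yy D n k) n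
    rw [Finset.sum_range_succ, y0] at e1
    rw [mul_zero, add_zero] at e1
    rw [← e1]; ring
  rw [h2, add_right_comm, ← Finset.sum_add_distrib, Finset.mul_sum, add_div, Finset.sum_div]
  congr 1
  · refine Finset.sum_congr rfl fun k _ => ?_
    field_simp
    ring
  · ring

lemma rpow_neg_step {β : ℝ} (hβ0 : 0 < β) (hβ1 : β ≤ 1) {n : ℕ} (hn : 1 ≤ n) :
    (1 - β / n) * (n:ℝ) ^ (-β) ≤ ((n + 1 : ℕ) : ℝ) ^ (-β) := by
  have hn0 : (0:ℝ) < n := by exact_mod_cast hn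
  have h3 : ((n + 1 : ℕ) : ℝ) = n * (1 + 1 / n) := by push_cast; field_simp
  have h2 : (1 + 1 / (n:ℝ)) ^ β ≤ 1 + β * (1 / n) :=
    rpow_one_add_le_one_add_mul_self (le_trans (by norm_num) (by positivity : (0:ℝ) ≤ 1 / (n:ℝ)))
      hβ0.le hβ1
  rw [h3, Real.mul_rpow hn0.le (by positivity), mul_comm]
  have hp : 0 < (1 + 1 / (n:ℝ)) ^ β := Real.rpow_pos_of_pos (by positivity) _
  have : 1 - β / n ≤ (1 + 1 / (n:ℝ)) ^ (-β) := by
    rw [Real.rpow_neg (by positivity), ← one_div, le_div_iff₀ hp]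
    have hb : 0 < β / n := by positivity
    have e : β * (1 / n) = β / n := by ring
    rw [e] at h2
    by_cases hc : 0 ≤ 1 - β / n
    · nlinarith
    · nlinarith
  gcongr

lemma zz_bound {D : ℕ → ℕ → ℕ → ℝ} (Dl : ∀ n s, D n 0 s = 0)
    (Dr : ∀ n r, D n r 0 = 0) (D0 : ∀ n r s, 0 ≤ D n r s)
    (hα0 : 0 < α) (hα1 : α < 1) (hθ : 0 < α + θ)
    (Drec : ∀ n, 1 ≤ n → ∀ r s, r + s ≤ n → D (n+1) r s ≤ ((n + θ - ((r:ℝ) + s - α)) * D n r s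
      + ((r:ℝ) - 1 - α) * D n (r-1) s + ((s:ℝ) - 1 - α) * D n r (s-1)) / (n + θ))
    {β c : ℝ} (hβ0 : 0 < β) (hβ1 : β ≤ 1) (hβ : 2 * β * (1 + |θ|) ≤ α) (hc : 0 ≤ c)
    (he : ∀ n, 1 ≤ n → yy D n n ≤ c * (n:ℝ) ^ (-β)) :
    ∃ C, 0 ≤ C ∧ ∀ n : ℕ, 1 ≤ n → ∑ k ∈ Finset.range (n+1), yy D n k ≤ C * (n:ℝ) ^ (-β) := by
  set C := 2 * (α + θ) * c / α with hC
  have hC0 : 0 ≤ C := by rw [hC]; positivity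
  have hCa : (α + θ) * c = C * α / 2 := by rw [hC]; field_simp
  have main : ∀ n : ℕ, 1 ≤ n → ∑ k ∈ Finset.range n, yy D n k ≤ C * (n:ℝ) ^ (-β) := by
    intro n hn
    induction n, hn using Nat.le_induction with
    | base => simp [yy, Dl, hC0]
    | succ n hn ih =>
      have hn1 : (1:ℝ) ≤ n := by exact_mod_cast hn
      have hpos : 0 < (n:ℝ) + θ := by linarith
      have hz := zz_rec Dl Dr hpos D0 hα0 (Drec n hn)
      have hr := rpow_neg_step hβ0 hβ1 hn
      rcases Nat.lt_or_ge n 2 with h2 | h2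
      · have : n = 1 := by omega
        subst this
        have e1 : yy D 1 1 = 0 := by
          simp [yy, Finset.Nat.antidiagonal_succ, Dl, Dr]
        have e2 : ∑ k ∈ Finset.range 1, yy D 1 k = 0 := by simp [yy, Dl]
        rw [e1, e2] at hz
        refine hz.trans ?_
        rw [mul_zero, mul_zero, add_zero]
        positivity
      · have hn2 : (2:ℝ) ≤ n := by exact_mod_cast h2
        have hco : 0 ≤ 1 - α / (n + θ) := by
          rw [sub_nonneg, div_le_one hpos]; linarith
        have hnb : 0 < (n:ℝ) ^ (-β) := Real.rpow_pos_of_pos (by linarith) _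
        calc _ ≤ _ := hz
          _ ≤ (1 - α / (n + θ)) * (C * (n:ℝ) ^ (-β))
              + (α + θ) / (n + θ) * (c * (n:ℝ) ^ (-β)) := by
              gcongr
              exact he n hn
          _ = (1 - α / (n + θ)) * (C * (n:ℝ) ^ (-β))
              + ((α + θ) * c) / (n + θ) * (n:ℝ) ^ (-β) := by ring
          _ = C * ((1 - (α / 2) / (n + θ)) * (n:ℝ) ^ (-β)) := by rw [hCa]; ring
          _ ≤ C * ((1 - β / n) * (n:ℝ) ^ (-β)) := by
              gcongr 3
              rw [div_le_div_iff₀ (by linarith) hpos]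
              have h5 : β * θ ≤ β * |θ| * n := by
                have : θ ≤ |θ| * n := (le_abs_self θ).trans
                  (le_mul_of_one_le_right (abs_nonneg _) hn1)
                nlinarith
              nlinarith
          _ ≤ _ := by gcongr
  refine ⟨C + c, by positivity, fun n hn => ?_⟩
  rw [Finset.sum_range_succ, add_mul]
  exact add_le_add (main n hn) (he n hn)

lemma diag_sum_le {D : ℕ → ℕ → ℕ → ℝ} (D0 : ∀ n r s, 0 ≤ D n r s)
    (Dout : ∀ n, 1 ≤ n → ∀ r s, n < r + s → D n r s = 0) {β C : ℝ} (hβ0 : 0 < β) (hC : 0 ≤ C)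
    (hz : ∀ n : ℕ, 1 ≤ n → ∑ k ∈ Finset.range (n+1), yy D n k ≤ C * (n:ℝ) ^ (-β))
    {n d : ℕ} (hn : 1 ≤ n) (hd : 1 ≤ d) (M : ℕ) :
    ∑ r ∈ Finset.Icc d M, D n r r ≤ C * (d:ℝ) ^ (-β) := by
  have hd0 : (0:ℝ) < d := by exact_mod_cast hd
  rcases Nat.lt_or_ge n d with hlt | hge
  · rw [Finset.sum_eq_zero]
    · positivity
    · intro r hr
      rw [Finset.mem_Icc] at hr
      exact Dout n hn r r (by omega)
  · have h1 : ∑ r ∈ Finset.Icc d M, D n r r ≤ ∑ k ∈ Finset.range (n+1), yy D n k := by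
      have e1 : ∑ r ∈ Finset.Icc d M, D n r r
          = ∑ r ∈ (Finset.Icc d M).filter (fun r => r + r ≤ n), D n r r := by
        rw [Finset.sum_filter]
        refine Finset.sum_congr rfl fun r _ => ?_
        split_ifs with hc
        · rfl
        · exact Dout n hn r r (by omega)
      have e2 : ∑ r ∈ (Finset.Icc d M).filter (fun r => r + r ≤ n), D n r r
          ≤ ∑ r ∈ (Finset.Icc d M).filter (fun r => r + r ≤ n), yy D n (r + r) := by
        refine Finset.sum_le_sum fun r _ => ?_
        exact Finset.single_le_sum (f := fun p : ℕ × ℕ => D n p.1 p.2) (fun _ _ => D0 _ _ _)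
          (Finset.HasAntidiagonal.mem_antidiagonal.2 rfl : (r, r) ∈ _)
      rw [e1]
      refine e2.trans ?_
      rw [← Finset.sum_image (s := (Finset.Icc d M).filter (fun r => r + r ≤ n))
        (g := fun r => r + r) (f := fun k => yy D n k)]
      · refine Finset.sum_le_sum_of_subset_of_nonneg ?_ fun _ _ _ => yy_nonneg D0 _ _
        intro k hk
        simp only [Finset.mem_image, Finset.mem_filter] at hk
        obtain ⟨r, ⟨_, hr⟩, rfl⟩ := hk
        rw [Finset.mem_range]; omega
      · intro a _ b _ hab
        simp only at hab
        omega
    refine h1.trans ((hz n hn).trans ?_)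
    refine mul_le_mul_of_nonneg_left ?_ hC
    exact Real.rpow_le_rpow_of_nonpos hd0 (by exact_mod_cast hge) (by linarith)

/-! ### The truncated excess -/

def DD (α θ : ℝ) {Ω : Type*} {mΩ : MeasurableSpace Ω} (μ : Measure Ω) (K : ℕ → Ω → ℕ)
    (B : ℕ → ℕ → Ω → ℕ) (C : ℝ) (n r s : ℕ) : ℝ :=
  max (uu α θ μ K B n r s - C / (r * s)) 0

lemma DD_rec (h : IsEwensPitman α θ μ F K B) (hα0 : 0 < α) (hα1 : α < 1)
    (hθ : 0 < α + θ) {C : ℝ} (hC : (1 + (α + θ)) ^ 2 ≤ α * C) {n : ℕ} (hn : 1 ≤ n) (r s : ℕ)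
    (hrs : r + s ≤ n) :
    DD α θ μ K B C (n+1) r s ≤ ((n + θ - ((r:ℝ) + s - α)) * DD α θ μ K B C n r s
      + ((r:ℝ) - 1 - α) * DD α θ μ K B C n (r-1) s
      + ((s:ℝ) - 1 - α) * DD α θ μ K B C n r (s-1)) / (n + θ) := by
  rcases r with _ | r
  · simp [DD, uu_zero_left]
  rcases s with _ | s
  · simp [DD, uu_zero_right]
  have hn1 : (1:ℝ) ≤ n := by exact_mod_cast hn
  have hpos : 0 < (n:ℝ) + θ := by linarith
  have hC0 : 0 ≤ C := by
    by_contra hc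
    have : 0 < (1 + (α + θ)) ^ 2 := by positivity
    nlinarith
  have hu := uu_rec h hα0 hα1 hθ hn hrs
  have hrs' : (r:ℝ) + 1 + (s + 1) ≤ n := by exact_mod_cast hrs
  have hr0 : (0:ℝ) < (r:ℝ) + 1 := by positivity
  have hs0 : (0:ℝ) < (s:ℝ) + 1 := by positivity
  have hV : ∀ m l : ℝ, ∀ k : ℕ, m = k → 0 < l →
      (m - α) * (C / (m * l)) ≤ (m + 1 - α) * (C / ((m + 1) * l)) := by
    intro m l k hm hl
    have hx : (m - α) * (1 / m) ≤ (m + 1 - α) * (1 / (m + 1)) := by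
      subst hm
      rcases Nat.eq_zero_or_pos k with h0 | h0
      · subst h0; simp; linarith
      · have : (0:ℝ) < k := by exact_mod_cast h0
        rw [mul_one_div, mul_one_div, div_le_div_iff₀ this (by linarith)]
        nlinarith
    have hcl : 0 ≤ C / l := by positivity
    calc _ = (m - α) * (1 / m) * (C / l) := by field_simp
      _ ≤ (m + 1 - α) * (1 / (m + 1)) * (C / l) := by gcongr
      _ = _ := by field_simp
  have v1 := hV r (s+1) r rfl hs0
  have v2 := hV s (r+1) s rfl hr0
  rw [mul_comm (s:ℝ) ((r:ℝ)+1), mul_comm ((s:ℝ)+1) ((r:ℝ)+1)] at v2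
  have hq : (1 + (α + θ)) ^ 2 * (qq α (r+1) * qq α (s+1))
      ≤ α * (C / (((r:ℝ)+1) * (s+1))) := by
    have q1 := qq_le hα0 hα1 (show 1 ≤ r + 1 by omega)
    have q2 := qq_le hα0 hα1 (show 1 ≤ s + 1 by omega)
    push_cast at q1 q2
    have n1 := qq_nonneg hα0 hα1 (r+1)
    have n2 := qq_nonneg hα0 hα1 (s+1)
    calc _ ≤ (α * C) * (1 / ((r:ℝ)+1) * (1 / ((s:ℝ)+1))) := by gcongr
      _ = _ := by field_simp
  have hd : ∀ m : ℕ, ∀ x : ℝ, (m = 0 → x = 0) → ((m:ℝ) - α) * x ≤ ((m:ℝ) - α) * max x 0 ∧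
      0 ≤ ((m:ℝ) - α) * max x 0 := by
    intro m x hx
    rcases Nat.eq_zero_or_pos m with h0 | h0
    · rw [hx h0]; simp
    · have : (1:ℝ) ≤ m := by exact_mod_cast h0
      have : 0 ≤ (m:ℝ) - α := by linarith
      exact ⟨mul_le_mul_of_nonneg_left (le_max_left _ _) this,
        mul_nonneg this (le_max_right _ _)⟩
  unfold DD
  simp only [Nat.add_sub_cancel]
  push_cast
  have d1 := hd r (uu α θ μ K B n r (s+1) - C / ((r:ℝ) * ((s:ℝ)+1)))
    (by intro h0; subst h0; simp [uu_zero_left])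
  have d2 := hd s (uu α θ μ K B n (r+1) s - C / (((r:ℝ)+1) * (s:ℝ)))
    (by intro h0; subst h0; simp [uu_zero_right])
  have hco : 0 ≤ n + θ - ((r:ℝ) + 1 + (s + 1) - α) := by linarith
  have d3 := mul_le_mul_of_nonneg_left
    (le_max_left (uu α θ μ K B n (r+1) (s+1) - C / (((r:ℝ)+1) * ((s:ℝ)+1))) 0) hco
  have d4 := mul_nonneg hco
    (le_max_right (uu α θ μ K B n (r+1) (s+1) - C / (((r:ℝ)+1) * ((s:ℝ)+1))) 0)
  refine max_le ?_ ?_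
  · rw [le_div_iff₀ hpos]
    rw [le_div_iff₀ hpos] at hu
    have e1 : (r:ℝ) + 1 - 1 - α = r - α := by ring
    have e2 : (s:ℝ) + 1 - 1 - α = s - α := by ring
    rw [e1, e2]
    generalize C / (((r:ℝ)+1) * ((s:ℝ)+1)) = V at *
    generalize C / ((r:ℝ) * ((s:ℝ)+1)) = V1 at *
    generalize C / (((r:ℝ)+1) * (s:ℝ)) = V2 at *
    linarith [d1.1, d2.1]
  · refine div_nonneg ?_ hpos.le
    have e1 : (r:ℝ) + 1 - 1 - α = r - α := by ring
    have e2 : (s:ℝ) + 1 - 1 - α = s - α := by ring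
    rw [e1, e2]
    linarith [d1.2, d2.2]

lemma DD_main (h : IsEwensPitman α θ μ F K B) (hα0 : 0 < α) (hα1 : α < 1)
    (hθ : 0 < α + θ) {β : ℝ} (hβ0 : 0 < β) (hβ1 : β ≤ 1) (hβα : 2 * β ≤ α)
    (hβθ : 4 * β ≤ α + θ) (hβ : 2 * β * (1 + |θ|) ≤ α) :
    ∃ C, 0 ≤ C ∧ ∀ n d M : ℕ, 1 ≤ n → 1 ≤ d →
      ∑ r ∈ Finset.Icc d M, DD α θ μ K B C n r r ≤ C * (d:ℝ) ^ (-β) := by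
  obtain ⟨Ce, hCe, hb⟩ := uu_boundary h hα0 hα1 hθ
  set C := Ce + (1 + (α + θ)) ^ 2 / α with hC
  have hC0 : 0 ≤ C := by rw [hC]; positivity
  have hC1 : (1 + (α + θ)) ^ 2 ≤ α * C := by
    rw [hC, mul_add, mul_div_cancel₀ _ hα0.ne']
    have := mul_nonneg hα0.le hCe
    linarith
  have hC2 : Ce ≤ C := by
    rw [hC]
    have : 0 ≤ (1 + (α + θ)) ^ 2 / α := by positivity
    linarith
  have Dl : ∀ n s, DD α θ μ K B C n 0 s = 0 := by intro n s; simp [DD, uu_zero_left]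
  have Dr : ∀ n r, DD α θ μ K B C n r 0 = 0 := by intro n s; simp [DD, uu_zero_right]
  have D0 : ∀ n r s, 0 ≤ DD α θ μ K B C n r s := fun n r s => le_max_right _ _
  have Dle : ∀ n r s : ℕ, 1 ≤ n → n ≤ r + s → DD α θ μ K B C n r s ≤ hh α θ μ K B n r s := by
    intro n r s hn hrs
    rcases Nat.eq_zero_or_pos r with h0 | h0
    · rw [h0, Dl]; exact hh_nonneg hα0 hθ _ _ _
    rcases Nat.eq_zero_or_pos s with h1 | h1
    · rw [h1, Dr]; exact hh_nonneg hα0 hθ _ _ _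
    refine max_le ?_ (hh_nonneg hα0 hθ _ _ _)
    have := hb n r s hn h0 h1 hrs
    have : Ce / ((r:ℝ) * s) ≤ C / (r * s) := by gcongr
    linarith
  have Dout : ∀ n, 1 ≤ n → ∀ r s, n < r + s → DD α θ μ K B C n r s = 0 := by
    intro n hn r s hrs
    rcases Nat.eq_zero_or_pos r with h0 | h0
    · rw [h0, Dl]
    rcases Nat.eq_zero_or_pos s with h1 | h1
    · rw [h1, Dr]
    refine le_antisymm ?_ (D0 _ _ _)
    rw [← hh_out h hn h0 h1 hrs]
    exact Dle n r s hn hrs.le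
  obtain ⟨C', hC', hz⟩ := zz_bound Dl Dr D0 hα0 hα1 hθ
    (fun n hn => DD_rec h hα0 hα1 hθ hC1 hn) hβ0 hβ1 hβ
    (c := 8 / (α + θ) * (1 + (α + |θ|) / β)) (by positivity)
    (by
      intro n hn
      refine le_trans ?_ (hh_diag h hα0 hα1 hθ hβ0 hβ1 hβα hβθ hn)
      refine Finset.sum_le_sum fun p hp => ?_
      rw [Finset.HasAntidiagonal.mem_antidiagonal] at hp
      exact Dle n p.1 p.2 hn hp.ge)
  have hmono : ∀ n r : ℕ, DD α θ μ K B (C + C') n r r ≤ DD α θ μ K B C n r r := by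
    intro n r
    unfold DD
    refine max_le_max ?_ le_rfl
    have : C / ((r:ℝ) * r) ≤ (C + C') / (r * r) := by gcongr; linarith
    linarith
  refine ⟨C + C', by positivity, fun n d M hn hd => ?_⟩
  calc _ ≤ ∑ r ∈ Finset.Icc d M, DD α θ μ K B C n r r :=
        Finset.sum_le_sum fun r _ => hmono n r
    _ ≤ C' * (d:ℝ) ^ (-β) := diag_sum_le D0 Dout hβ0 hC' hz hn hd M
    _ ≤ _ := by gcongr; linarith


/-! ### Final bound -/

lemma Q_pointwise (hα0 : 0 < α) (hα1 : α < 1) (hθ : 0 < α + θ) :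
    ∃ A1 A2 A3 : ℝ, 0 ≤ A1 ∧ 0 ≤ A2 ∧ 0 ≤ A3 ∧ ∀ (n k : ℕ) (b : ℕ → ℕ) (r : ℕ),
      GoodState n k b → 1 ≤ n → 1 ≤ r →
      (k:ℝ) * ((b r : ℝ) / k - sibuya α r) ^ 2
        ≤ A1 * (ww α θ k * Uu α (bb b) (α * ((k:ℝ) - 1) + θ) r r)
          + A2 * ((b r : ℝ) / k) + A3 * (1 / (r:ℝ) ^ 2) := by
  set A := α + |θ| with hA
  set m := min α (α + θ) with hm
  have hm0 : 0 < m := lt_min hα0 hθ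
  have hA0 : 0 ≤ A := by positivity
  refine ⟨2 * A, 2 * A * (2 / m) + 2, 2 * (α - θ) ^ 2 + 2, by positivity, by positivity,
    by positivity, ?_⟩
  intro n k b r hg hn hr
  have hr0 : (0:ℝ) < r := by exact_mod_cast hr
  have hk := hg.pos hn
  have hk' : (1:ℝ) ≤ k := by exact_mod_cast hk
  have hk0 : (0:ℝ) < k := by linarith
  have hq := qq_nonneg hα0 hα1 r
  have hq1 := qq_le hα0 hα1 hr
  have hsib : sibuya α r = α * qq α r := by
    rw [qq, if_neg (by omega)]; field_simp
  have hqsq : qq α r ^ 2 ≤ 1 / (r:ℝ) ^ 2 := by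
    calc qq α r ^ 2 ≤ (1 / (r:ℝ)) ^ 2 := by gcongr
      _ = _ := by rw [div_pow, one_pow]
  have hbr : bb b r = b r := by rw [bb, if_neg (by omega)]
  have hb0 : (0:ℝ) ≤ b r := by positivity
  have hb1 : (b r : ℝ) ≤ k := by exact_mod_cast hg.b_le hr
  rw [hsib]
  generalize (1 / (r:ℝ) ^ 2) = ρ at *
  have hρ : 0 ≤ ρ := (sq_nonneg _).trans hqsq
  rcases Nat.lt_or_ge k 2 with hlt | hge
  · have h1 : k = 1 := by omega
    have w0 : ww α θ k = 0 := by unfold ww; rw [if_pos (by omega)]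
    rw [w0]
    rw [h1] at hb1 ⊢
    simp only [Nat.cast_one, div_one, one_mul, zero_mul, mul_zero, zero_add] at hb1 ⊢
    have h2 : ((b r : ℝ) - α * qq α r) ^ 2 ≤ 2 * (b r : ℝ) ^ 2 + 2 * (α * qq α r) ^ 2 := by
      nlinarith [sq_nonneg ((b r : ℝ) + α * qq α r)]
    have h3 : (b r : ℝ) ^ 2 ≤ b r := by nlinarith
    have h4 : (α * qq α r) ^ 2 ≤ ρ := by
      rw [mul_pow]
      have : α ^ 2 ≤ 1 := by nlinarith
      exact (mul_le_of_le_one_left (sq_nonneg _) this).trans hqsq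
    have h5 : 0 ≤ 2 * A * (2 / m) * b r := by positivity
    have h6 : 0 ≤ 2 * (α - θ) ^ 2 * ρ := by positivity
    linarith
  · have hge' : (2:ℝ) ≤ k := by exact_mod_cast hge
    have hJ0 : 0 < α * ((k:ℝ) - 1) + θ := by nlinarith
    have w1 : ww α θ k = 1 / (α * ((k:ℝ) - 1) + θ) := by unfold ww; rw [if_neg (by omega)]
    have hJA : α * ((k:ℝ) - 1) + θ ≤ A * k := by
      have : θ ≤ |θ| * k := (le_abs_self θ).trans (le_mul_of_one_le_right (abs_nonneg _) hk')
      rw [hA]; nlinarith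
    have hJm : m * (k / 2) ≤ α * ((k:ℝ) - 1) + θ := by
      have m1 : m ≤ α := min_le_left _ _
      have m2 : m ≤ α + θ := min_le_right _ _
      nlinarith
    have hαk : α * (k:ℝ) = (α * ((k:ℝ) - 1) + θ) + (α - θ) := by ring
    rw [w1]
    simp only [Uu, hbr, if_true]
    set J := α * ((k:ℝ) - 1) + θ
    set M := (b r : ℝ) - qq α r * J with hM
    have e1 : (k:ℝ) * ((b r : ℝ) / k - α * qq α r) ^ 2 = (M - qq α r * (α - θ)) ^ 2 / k := by
      have : M - qq α r * (α - θ) = b r - qq α r * (α * k) := by rw [hM, hαk]; ring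
      rw [this]; field_simp
    have h1 : (M - qq α r * (α - θ)) ^ 2 ≤ 2 * M ^ 2 + 2 * ((α - θ) ^ 2 * ρ) := by
      have : (α - θ) ^ 2 * qq α r ^ 2 ≤ (α - θ) ^ 2 * ρ := by gcongr
      nlinarith [sq_nonneg (M + qq α r * (α - θ))]
    have h2 : M ^ 2 / k ≤ A * (1 / J * M ^ 2) := by
      have : 1 / (k:ℝ) ≤ A * (1 / J) := by
        rw [mul_one_div, div_le_div_iff₀ hk0 hJ0]; linarith
      calc M ^ 2 / k = 1 / (k:ℝ) * M ^ 2 := by ring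
        _ ≤ A * (1 / J) * M ^ 2 := by gcongr
        _ = _ := by ring
    have h3 : 1 / J * (b r : ℝ) ≤ 2 / m * ((b r : ℝ) / k) := by
      have : 1 / J ≤ 2 / m * (1 / k) := by
        rw [div_mul_div_comm, div_le_div_iff₀ hJ0 (by positivity)]
        linarith
      calc _ ≤ 2 / m * (1 / k) * (b r : ℝ) := by gcongr
        _ = _ := by ring
    have h4 : (α - θ) ^ 2 * ρ / k ≤ (α - θ) ^ 2 * ρ := div_le_self (by positivity) hk'
    rw [e1]
    have h5 : (M - qq α r * (α - θ)) ^ 2 / k ≤ 2 * (M ^ 2 / k) + 2 * ((α - θ) ^ 2 * ρ / k) := by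
      calc _ ≤ (2 * M ^ 2 + 2 * ((α - θ) ^ 2 * ρ)) / k := by gcongr
        _ = _ := by ring
    have h6 : A * (1 / J * (b r : ℝ)) ≤ A * (2 / m * ((b r : ℝ) / k)) := by gcongr
    have h7 : 0 ≤ (b r : ℝ) / k := by positivity
    have h8 : 1 / J * (M * M - (b r : ℝ)) = 1 / J * M ^ 2 - 1 / J * (b r : ℝ) := by ring
    rw [h8]
    linarith

lemma inv_sq_sum {d : ℕ} (hd : 1 ≤ d) (M : ℕ) :
    ∑ r ∈ Finset.Icc d M, 1 / (r:ℝ) ^ 2 ≤ 2 / (d:ℝ) := by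
  have := sum_Ioo_inv_sq_le (α := ℝ) (d - 1) (M + 1)
  have e : Finset.Ioo (d-1) (M+1) = Finset.Icc d M := by
    ext x; simp only [Finset.mem_Ioo, Finset.mem_Icc]; omega
  rw [e] at this
  have e2 : (((d - 1 : ℕ) : ℝ) + 1) = d := by
    rw [Nat.cast_sub hd]; push_cast; ring
  rw [e2] at this
  simpa only [one_div] using this

lemma tail_B {β : ℝ} (hβ0 : 0 < β) {n k : ℕ} {b : ℕ → ℕ} (hg : GoodState n k b)
    {d : ℕ} (hd : 1 ≤ d) (M : ℕ) :
    ∑ r ∈ Finset.Icc d M, (b r : ℝ) / k ≤ (d:ℝ) ^ (-β) * (Gs β n b / k) := by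
  have hd0 : (0:ℝ) < d := by exact_mod_cast hd
  rw [← Finset.sum_div, ← mul_div_assoc]
  refine div_le_div_of_nonneg_right ?_ (by positivity)
  have e1 : ∑ r ∈ Finset.Icc d M, (b r : ℝ)
      = ∑ r ∈ (Finset.Icc d M).filter (fun r => r ≤ n), (b r : ℝ) := by
    rw [Finset.sum_filter]
    refine Finset.sum_congr rfl fun r _ => ?_
    split_ifs with hc
    · rfl
    · rw [hg.hz r (by omega)]; simp
  rw [e1, Gs, Finset.mul_sum]
  calc _ ≤ ∑ r ∈ (Finset.Icc d M).filter (fun r => r ≤ n), (d:ℝ) ^ (-β) * ((r:ℝ) ^ β * b r) := by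
        refine Finset.sum_le_sum fun r hr => ?_
        simp only [Finset.mem_filter, Finset.mem_Icc] at hr
        have h1 : (d:ℝ) ^ β ≤ (r:ℝ) ^ β :=
          Real.rpow_le_rpow hd0.le (by exact_mod_cast hr.1.1) hβ0.le
        have h2 : (d:ℝ) ^ (-β) * (d:ℝ) ^ β = 1 := by
          rw [← Real.rpow_add hd0]; simp
        have h3 : 1 ≤ (d:ℝ) ^ (-β) * (r:ℝ) ^ β := by
          rw [← h2]; gcongr
        rw [← mul_assoc]
        exact le_mul_of_one_le_left (by positivity) h3
    _ ≤ _ := by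
        refine Finset.sum_le_sum_of_subset_of_nonneg ?_ fun _ _ _ => by positivity
        intro r hr
        simp only [Finset.mem_filter, Finset.mem_Icc] at hr ⊢
        omega

lemma Q_int (h : IsEwensPitman α θ μ F K B) {n r : ℕ} (hn : 1 ≤ n) (hr : 1 ≤ r) :
    Integrable (fun ω => (K n ω : ℝ) * ((B r n ω : ℝ) / (K n ω : ℝ) - sibuya α r) ^ 2) μ :=
  fn_int h hn hr hr (fun k x _ => (k:ℝ) * ((x:ℝ) / k - sibuya α r) ^ 2)

lemma Q_tail (h : IsEwensPitman α θ μ F K B) (hα0 : 0 < α) (hα1 : α < 1)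
    (hθ : 0 < α + θ) : ∃ β C : ℝ, 0 < β ∧ 0 ≤ C ∧ ∀ n d M : ℕ, 1 ≤ n → 1 ≤ d →
      ∑ r ∈ Finset.Icc d M,
        ∫ ω, (K n ω : ℝ) * ((B r n ω : ℝ) / (K n ω : ℝ) - sibuya α r) ^ 2 ∂μ
        ≤ C * ((d:ℝ) ^ (-β) + 2 / d) := by
  have hprob := h.prob
  set β := min (α / (2 * (1 + |θ|))) ((α + θ) / 4) with hβd
  have hβ0 : 0 < β := lt_min (by positivity) (by positivity)
  have hβ : 2 * β * (1 + |θ|) ≤ α := by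
    have : β ≤ α / (2 * (1 + |θ|)) := min_le_left _ _
    rw [le_div_iff₀ (by positivity)] at this
    linarith
  have hβθ : 4 * β ≤ α + θ := by
    have : β ≤ (α + θ) / 4 := min_le_right _ _
    linarith
  have hβα : 2 * β ≤ α := by nlinarith [abs_nonneg θ, mul_nonneg hβ0.le (abs_nonneg θ)]
  have hβ1 : β ≤ 1 := by linarith
  obtain ⟨C, hC, hD⟩ := DD_main h hα0 hα1 hθ hβ0 hβ1 hβα hβθ hβ
  obtain ⟨A1, A2, A3, hA1, hA2, hA3, hQ⟩ := Q_pointwise hα0 hα1 hθ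
  set G := 1 + (α + |θ|) / β with hG
  have hG0 : 0 ≤ G := by positivity
  refine ⟨β, A1 * C + A3 + A2 * G, hβ0, by positivity, fun n d M hn hd => ?_⟩
  have hd0 : (0:ℝ) < d := by exact_mod_cast hd
  have hdb : 0 < (d:ℝ) ^ (-β) := Real.rpow_pos_of_pos hd0 _
  obtain ⟨iG, bG⟩ := G_bound h hα0 hα1 hθ hβ0 hβ1 hβα hβθ hn
  have iB : ∀ r, 1 ≤ r → Integrable (fun ω => (B r n ω : ℝ) / (K n ω : ℝ)) μ := fun r hr =>
    fn_int h hn hr hr (fun k x _ => (x:ℝ) / k)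
  have h1 : ∀ r ∈ Finset.Icc d M,
      ∫ ω, (K n ω : ℝ) * ((B r n ω : ℝ) / (K n ω : ℝ) - sibuya α r) ^ 2 ∂μ
      ≤ A1 * DD α θ μ K B C n r r + (A1 * C + A3) * (1 / (r:ℝ) ^ 2)
        + A2 * ∫ ω, (B r n ω : ℝ) / (K n ω : ℝ) ∂μ := by
    intro r hr
    have hr1 : 1 ≤ r := hd.trans (Finset.mem_Icc.1 hr).1
    have i1 := (uu_int h hn r r).const_mul A1
    have i2 := (iB r hr1).const_mul A2
    have i12 := i1.add i2
    have i3 := integrable_const (μ := μ) (A3 * (1 / (r:ℝ) ^ 2))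
    have key := integral_mono_ae (Q_int h hn hr1) (i12.add i3) (by
      filter_upwards [h.good hn] with ω hg
      exact hQ n (K n ω) (fun i => B i n ω) r hg hn hr1)
    refine key.trans ?_
    rw [integral_add' i12 i3, integral_add' i1 i2, integral_const_mul, integral_const_mul]
    simp only [integral_const, probReal_univ, smul_eq_mul, one_mul]
    have hu : uu α θ μ K B n r r ≤ DD α θ μ K B C n r r + C * (1 / (r:ℝ) ^ 2) := by
      have : uu α θ μ K B n r r - C / ((r:ℝ) * r) ≤ DD α θ μ K B C n r r := le_max_left _ _
      have e : C / ((r:ℝ) * r) = C * (1 / (r:ℝ) ^ 2) := by rw [sq, mul_one_div]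
      linarith
    have hu' := mul_le_mul_of_nonneg_left hu hA1
    unfold uu at hu'
    linarith
  have h2 : ∑ r ∈ Finset.Icc d M, ∫ ω, (B r n ω : ℝ) / (K n ω : ℝ) ∂μ ≤ (d:ℝ) ^ (-β) * G := by
    have ib : ∀ r ∈ Finset.Icc d M, Integrable (fun ω => (B r n ω : ℝ) / (K n ω : ℝ)) μ :=
      fun r hr => iB r (hd.trans (Finset.mem_Icc.1 hr).1)
    rw [← integral_finsetSum _ ib]
    refine (integral_mono_ae (integrable_finsetSum _ ib)
      (iG.const_mul ((d:ℝ) ^ (-β))) ?_).trans ?_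
    · filter_upwards [h.good hn] with ω hg
      exact tail_B hβ0 hg hd M
    · rw [integral_const_mul]
      gcongr
  have h3 := hD n d M hn hd
  have h4 := inv_sq_sum hd M
  calc _ ≤ ∑ r ∈ Finset.Icc d M, (A1 * DD α θ μ K B C n r r + (A1 * C + A3) * (1 / (r:ℝ) ^ 2)
        + A2 * ∫ ω, (B r n ω : ℝ) / (K n ω : ℝ) ∂μ) := Finset.sum_le_sum h1
    _ = A1 * ∑ r ∈ Finset.Icc d M, DD α θ μ K B C n r r
        + (A1 * C + A3) * ∑ r ∈ Finset.Icc d M, 1 / (r:ℝ) ^ 2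
        + A2 * ∑ r ∈ Finset.Icc d M, ∫ ω, (B r n ω : ℝ) / (K n ω : ℝ) ∂μ := by
        rw [Finset.sum_add_distrib, Finset.sum_add_distrib, Finset.mul_sum, Finset.mul_sum,
          Finset.mul_sum]
    _ ≤ A1 * (C * (d:ℝ) ^ (-β)) + (A1 * C + A3) * (2 / d) + A2 * ((d:ℝ) ^ (-β) * G) := by
        gcongr
    _ ≤ _ := by
        have p1 : 0 ≤ A3 * (d:ℝ) ^ (-β) := by positivity
        have p2 : 0 ≤ A2 * G * (2 / d) := by positivity
        linarith

lemma final (h : IsEwensPitman α θ μ F K B) (hα0 : 0 < α) (hα1 : α < 1)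
    (hθ : 0 < α + θ) :
    Tendsto
      (fun d : ℕ => ⨆ n ∈ Set.Ici 1, ∑' r : ℕ,
        if d ≤ r ∧ 1 ≤ r then
          ∫⁻ ω, ENNReal.ofReal ((K n ω : ℝ) *
            ((B r n ω : ℝ) / (K n ω : ℝ) - sibuya α r) ^ 2) ∂μ
        else 0)
      atTop (𝓝 0) := by
  obtain ⟨β, C, hβ0, hC, hT⟩ := Q_tail h hα0 hα1 hθ
  have lim : Tendsto (fun d : ℕ => ENNReal.ofReal (C * ((d:ℝ) ^ (-β) + 2 / d))) atTop (𝓝 0) := by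
    have t1 : Tendsto (fun d : ℕ => (d:ℝ) ^ (-β)) atTop (𝓝 0) :=
      (tendsto_rpow_neg_atTop hβ0).comp tendsto_natCast_atTop_atTop
    have t2 : Tendsto (fun d : ℕ => (2:ℝ) / d) atTop (𝓝 0) :=
      tendsto_const_div_atTop_nhds_zero_nat 2
    have t3 := (t1.add t2).const_mul C
    have t4 := ENNReal.tendsto_ofReal t3
    simpa using t4
  refine tendsto_of_tendsto_of_tendsto_of_le_of_le' tendsto_const_nhds lim
    (Eventually.of_forall fun _ => zero_le) ?_
  filter_upwards [eventually_ge_atTop 1] with d hd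
  refine iSup₂_le fun n hn => ?_
  have hn1 : 1 ≤ n := hn
  refine ENNReal.tsum_le_of_sum_range_le fun N => ?_
  have hlin : ∀ r, 1 ≤ r → ∫⁻ ω, ENNReal.ofReal ((K n ω : ℝ) *
      ((B r n ω : ℝ) / (K n ω : ℝ) - sibuya α r) ^ 2) ∂μ
      = ENNReal.ofReal (∫ ω, (K n ω : ℝ) * ((B r n ω : ℝ) / (K n ω : ℝ) - sibuya α r) ^ 2 ∂μ) := by
    intro r hr
    rw [ofReal_integral_eq_lintegral_ofReal (Q_int h hn1 hr)
      (Eventually.of_forall fun ω => by dsimp only [Pi.zero_apply]; positivity)]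
  calc _ = ∑ r ∈ (Finset.range N).filter (fun r => d ≤ r ∧ 1 ≤ r),
        ∫⁻ ω, ENNReal.ofReal ((K n ω : ℝ) *
          ((B r n ω : ℝ) / (K n ω : ℝ) - sibuya α r) ^ 2) ∂μ := by rw [Finset.sum_filter]
    _ ≤ ∑ r ∈ Finset.Icc d N, ∫⁻ ω, ENNReal.ofReal ((K n ω : ℝ) *
          ((B r n ω : ℝ) / (K n ω : ℝ) - sibuya α r) ^ 2) ∂μ := by
        refine Finset.sum_le_sum_of_subset ?_
        intro r hr
        simp only [Finset.mem_filter, Finset.mem_range, Finset.mem_Icc] at hr ⊢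
        omega
    _ = ∑ r ∈ Finset.Icc d N, ENNReal.ofReal (∫ ω, (K n ω : ℝ) *
          ((B r n ω : ℝ) / (K n ω : ℝ) - sibuya α r) ^ 2 ∂μ) :=
        Finset.sum_congr rfl fun r hr => hlin r (hd.trans (Finset.mem_Icc.1 hr).1)
    _ = ENNReal.ofReal (∑ r ∈ Finset.Icc d N, ∫ ω, (K n ω : ℝ) *
          ((B r n ω : ℝ) / (K n ω : ℝ) - sibuya α r) ^ 2 ∂μ) := by
        rw [ENNReal.ofReal_sum_of_nonneg]
        intro r _
        exact integral_nonneg fun ω => by dsimp only [Pi.zero_apply]; positivity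
    _ ≤ _ := ENNReal.ofReal_le_ofReal (hT n d N hn1 hd)

end chain

/-- Uniform control of the tails of `E[Q_{r,n}²]`, with
`Q_{r,n} = √(K_n)(P_{r,n} - p_α(r))`: `lim_{d→∞} sup_{n≥1} ∑_{r=d}^∞ E[Q_{r,n}²] = 0`
(which yields tightness in `ℓ²` of the sequence `Q_n = (Q_{1,n}, Q_{2,n}, …)`). -/
theorem tail_second_moment_tendsto_zero (α θ : ℝ) (hα0 : 0 < α) (hα1 : α < 1)
    (hθ : 0 < α + θ)
    {Ω : Type*} [mΩ : MeasurableSpace Ω] (μ : Measure Ω) (F : Filtration ℕ mΩ)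
    (K : ℕ → Ω → ℕ) (B : ℕ → ℕ → Ω → ℕ) (hEP : IsEwensPitman α θ μ F K B) :
    Tendsto
      (fun d : ℕ => ⨆ n ∈ Set.Ici 1, ∑' r : ℕ,
        if d ≤ r ∧ 1 ≤ r then
          ∫⁻ ω, ENNReal.ofReal ((K n ω : ℝ) *
            ((B r n ω : ℝ) / (K n ω : ℝ) - sibuya α r) ^ 2) ∂μ
        else 0)
      atTop (𝓝 0) := by
  exact final hEP hα0 hα1 hθ

end
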